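/- Let U be an open set in ℝⁿ, n ≥ 3, and let φ: [0,∞) → [0,∞) be increasing with ∫₁^∞ (t/φ(t))^{1/(n−2)} dt < ∞. Then every continuous mapping f: U → ℝᵐ, m ≥ 1, in the class W^{1,φ}_loc has the following property: for each coordinate hyperplane 𝒫₀ of ℝⁿ, for almost every hyperplane 𝒫 parallel to 𝒫₀ (with respect to (n−1)-dimensional Lebesgue measure parametrizing such translates), the restriction of f to 𝒫 ∩ U satisfies the Lusin (N)-property with respect to (n−1)-dimensional Hausdorff measure (indeed it is locally absolutely continuous there); moreover, for almost every such hyperplane 𝒫, if E ⊆ 𝒫 ∩ U and |∇f| = 0 on E, then H^{n−1}(f(E)) = 0. -/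

import Mathlib

open MeasureTheory Set Metric Topology ENNReal

noncomputable section

abbrev Euc (n : ℕ) : Type := EuclideanSpace ℝ (Fin n)

/-- `Df` is a weak (distributional) Jacobian of `f` on the open set `Ω`, and both `f` and
`Df` are locally integrable on `Ω`; this encodes `f ∈ W^{1,1}_loc(Ω)` with weak derivative `Df`. -/
def IsWeakFDerivOn {n m : ℕ} (Ω : Set (Euc n)) (f : Euc n → Euc m)
    (Df : Euc n → (Euc n →L[ℝ] Euc m)) : Prop :=
  LocallyIntegrableOn f Ω volume ∧
  LocallyIntegrableOn (fun x => Df x) Ω volume ∧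
  ∀ ψ : Euc n → ℝ, ContDiff ℝ (⊤ : ℕ∞) ψ → HasCompactSupport ψ → tsupport ψ ⊆ Ω →
    ∀ v : Euc n, ∫ x in Ω, ψ x • Df x v = - ∫ x in Ω, (fderiv ℝ ψ x v) • f x

/-- The "gradient norm" `|∇f| = sqrt (Σ_{i,j} (∂f_i/∂x_j)²)` of a Jacobian matrix. -/
def frobNorm {n m : ℕ} (A : Euc n →L[ℝ] Euc m) : ℝ :=
  Real.sqrt (∑ i : Fin m, ∑ j : Fin n, (A (EuclideanSpace.single j (1:ℝ)) i) ^ 2)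

/- The dilatation `K_{p,f}(x)` built from the Jacobian matrix `A = f'(x)`:
`‖A‖^p / det A` if `det A ≠ 0`, `1` if `A = 0`, and `∞` otherwise. -/
open Classical in
def dilatation {n : ℕ} (p : ℝ) (A : Euc n →L[ℝ] Euc n) : ℝ≥0∞ :=
  if LinearMap.det (A : Euc n →ₗ[ℝ] Euc n) ≠ 0 then
    ENNReal.ofReal (‖A‖ ^ p / LinearMap.det (A : Euc n →ₗ[ℝ] Euc n))
  else if A = 0 then 1 else ⊤

/-- The Calderón-type condition `∫₁^∞ (t/φ(t))^{1/(n-2)} dt < ∞`. -/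
def CalderonCondition (n : ℕ) (φ : ℝ → ℝ) : Prop :=
  ∫⁻ t in Ioi (1:ℝ), (ENNReal.ofReal t / ENNReal.ofReal (φ t)) ^ (1 / ((n : ℝ) - 2)) < ⊤

/-- `f` belongs to the Orlicz–Sobolev class `W^{1,φ}_loc(Ω)` with weak Jacobian `Df`. -/
def MemOrliczSobolevWith {n m : ℕ} (φ : ℝ → ℝ) (Ω : Set (Euc n)) (f : Euc n → Euc m)
    (Df : Euc n → (Euc n →L[ℝ] Euc m)) : Prop :=
  IsWeakFDerivOn Ω f Df ∧
  ∀ K : Set (Euc n), K ⊆ Ω → IsCompact K →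
    ∫⁻ x in K, ENNReal.ofReal (φ (frobNorm (Df x))) ∂volume < ⊤

/-- The Lusin (N)-property of `f` on the set `A` with respect to the `d`-dimensional
Hausdorff measure. -/
def LusinNOn {n m : ℕ} (f : Euc n → Euc m) (A : Set (Euc n)) (d : ℝ) : Prop :=
  ∀ B ⊆ A, μH[d] B = 0 → μH[d] (f '' B) = 0

/-- `f` is locally absolutely continuous on the set `A` with respect to the `d`-dimensional
Hausdorff measure. -/
def LocAbsContOn {n m : ℕ} (f : Euc n → Euc m) (A : Set (Euc n)) (d : ℝ) : Prop :=
  ∀ x ∈ A, ∃ U : Set (Euc n), IsOpen U ∧ x ∈ U ∧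
    ∀ ε : ℝ, 0 < ε → ∃ δ : ℝ, 0 < δ ∧
      ∀ B ⊆ A ∩ U, μH[d] B < ENNReal.ofReal δ → μH[d] (f '' B) < ENNReal.ofReal ε


/-- The closed dyadic cube of side `2⁻ᴺ` with lower corner `a / 2ᴺ`. -/
def dyadicCube {k : ℕ} (N : ℕ) (a : Fin k → ℤ) : Set (Fin k → ℝ) :=
  Icc (fun l => (a l : ℝ) / 2 ^ N) (fun l => ((a l : ℝ) + 1) / 2 ^ N)

/-- The index of the dyadic cube of generation `N` to which `x` is assigned. -/
def dyadicIndex {k : ℕ} (N : ℕ) (x : Fin k → ℝ) : Fin k → ℤ := fun l => ⌊x l * 2 ^ N⌋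

lemma measurableSet_dyadicCube {k : ℕ} (N : ℕ) (a : Fin k → ℤ) :
    MeasurableSet (dyadicCube N a) := measurableSet_Icc

lemma isCompact_dyadicCube {k : ℕ} (N : ℕ) (a : Fin k → ℤ) :
    IsCompact (dyadicCube N a) := isCompact_Icc

lemma volume_dyadicCube {k : ℕ} (N : ℕ) (a : Fin k → ℤ) :
    volume (dyadicCube N a) = ((2 : ℝ≥0∞) ^ (N * k))⁻¹ := by
  rw [dyadicCube, Real.volume_Icc_pi]
  have : ∀ l : Fin k, ((a l : ℝ) + 1) / 2 ^ N - (a l : ℝ) / 2 ^ N = (2 ^ N)⁻¹ := fun l => by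
    ring
  simp only [this]
  rw [Finset.prod_const, Finset.card_univ, Fintype.card_fin,
    ENNReal.ofReal_inv_of_pos (by positivity), ENNReal.ofReal_pow (by norm_num),
    ENNReal.ofReal_ofNat, ← ENNReal.inv_pow, pow_mul]

lemma mem_dyadicCube_dyadicIndex {k : ℕ} (N : ℕ) (x : Fin k → ℝ) :
    x ∈ dyadicCube N (dyadicIndex N x) := by
  have h2 : (0 : ℝ) < 2 ^ N := by positivity
  refine ⟨fun l => ?_, fun l => ?_⟩
  · rw [div_le_iff₀ h2]
    exact Int.floor_le _
  · rw [le_div_iff₀ h2]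
    exact (Int.lt_floor_add_one _).le

lemma dyadicCube_succ_subset {k : ℕ} (N : ℕ) (x : Fin k → ℝ) :
    dyadicCube (N + 1) (dyadicIndex (N + 1) x) ⊆ dyadicCube N (dyadicIndex N x) := by
  have h2 : (0 : ℝ) < 2 ^ N := by positivity
  have key : ∀ l, 2 * dyadicIndex N x l ≤ dyadicIndex (N + 1) x l ∧
      dyadicIndex (N + 1) x l ≤ 2 * dyadicIndex N x l + 1 := fun l => by
    simp only [dyadicIndex]
    have h1 := Int.floor_le (x l * 2 ^ N)
    have h3 := Int.lt_floor_add_one (x l * 2 ^ N)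
    constructor
    · rw [Int.le_floor]
      push_cast
      rw [pow_succ]
      linarith
    · rw [← Int.lt_add_one_iff, Int.floor_lt]
      push_cast
      rw [pow_succ]
      linarith
  rintro y ⟨hy1, hy2⟩
  refine ⟨fun l => ?_, fun l => ?_⟩
  · have h := hy1 l
    have h' : (2 * dyadicIndex N x l : ℝ) ≤ dyadicIndex (N + 1) x l := by exact_mod_cast (key l).1
    simp only [div_le_iff₀ h2, div_le_iff₀ (show (0 : ℝ) < 2 ^ (N + 1) by positivity)] at h ⊢
    rw [pow_succ] at h
    linarith
  · have h := hy2 l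
    have h' : (dyadicIndex (N + 1) x l : ℝ) ≤ 2 * dyadicIndex N x l + 1 := by
      exact_mod_cast (key l).2
    simp only [le_div_iff₀ h2, le_div_iff₀ (show (0 : ℝ) < 2 ^ (N + 1) by positivity)] at h ⊢
    rw [pow_succ] at h
    linarith

lemma dyadicCube_subset_closedBall {k : ℕ} {N : ℕ} {a : Fin k → ℤ} {x : Fin k → ℝ}
    (hx : x ∈ dyadicCube N a) : dyadicCube N a ⊆ closedBall x ((1 / 2) ^ N) := by
  intro y hy
  rw [mem_closedBall, dist_pi_le_iff (by positivity)]
  intro l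
  have := Real.dist_le_of_mem_Icc ⟨hy.1 l, hy.2 l⟩ ⟨hx.1 l, hx.2 l⟩
  refine this.trans_eq ?_
  rw [one_div, inv_pow]
  ring

/-- The dyadic cubes of a fixed generation do not overlap. -/
lemma tsum_setLIntegral_dyadicCube_le {k : ℕ} (N : ℕ) (W : Set (Fin k → ℝ))
    (S : Set (Fin k → ℤ)) (hS : ∀ a ∈ S, dyadicCube N a ⊆ W) (u : (Fin k → ℝ) → ℝ≥0∞) :
    ∑' a : S, ∫⁻ x in dyadicCube N a.1, u x ≤ ∫⁻ x in W, u x := by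
  obtain ⟨P, hPdef⟩ : ∃ P : (Fin k → ℤ) → Set (Fin k → ℝ), ∀ a, P a =
    univ.pi fun l => Ico ((a l : ℝ) / 2 ^ N) (((a l : ℝ) + 1) / 2 ^ N) := ⟨_, fun _ => rfl⟩
  have hmem : ∀ a x, x ∈ P a ↔ ∀ l, (a l : ℝ) / 2 ^ N ≤ x l ∧ x l < ((a l : ℝ) + 1) / 2 ^ N :=
    fun a x => by simp [hPdef]
  have hP : ∀ a, MeasurableSet (P a) := fun a => by
    rw [hPdef]
    exact MeasurableSet.univ_pi fun l => measurableSet_Ico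
  have hPQ : ∀ a, (P a : Set _) =ᵐ[volume] dyadicCube N a := fun a => by
    rw [hPdef]
    exact Measure.univ_pi_Ico_ae_eq_Icc (μ := fun _ : Fin k => (volume : Measure ℝ))
  have hsub : ∀ a, P a ⊆ dyadicCube N a := fun a x hx =>
    ⟨fun l => ((hmem a x).1 hx l).1, fun l => ((hmem a x).1 hx l).2.le⟩
  have hidx : ∀ a x, x ∈ P a → a = dyadicIndex N x := by
    intro a x hx
    funext l
    have h2 : (0 : ℝ) < 2 ^ N := by positivity
    obtain ⟨h3, h4⟩ := (hmem a x).1 hx l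
    symm
    rw [dyadicIndex, Int.floor_eq_iff]
    exact ⟨(div_le_iff₀ h2).1 h3, (lt_div_iff₀ h2).1 h4⟩
  have hdisj : Pairwise (Function.onFun Disjoint fun a : S => P a.1) := by
    intro a b hab
    refine Set.disjoint_left.2 fun x hxa hxb => hab (Subtype.ext ?_)
    rw [hidx _ _ hxa, hidx _ _ hxb]
  calc ∑' a : S, ∫⁻ x in dyadicCube N a.1, u x = ∑' a : S, ∫⁻ x in P a.1, u x :=
        tsum_congr fun a => (setLIntegral_congr (hPQ a.1)).symm
    _ = ∫⁻ x in ⋃ a : S, P a.1, u x := (lintegral_iUnion (fun a : S => hP a.1) hdisj _).symm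
    _ ≤ ∫⁻ x in W, u x :=
        lintegral_mono_set (iUnion_subset fun a : S => (hsub a.1).trans (hS a.1 a.2))

lemma enorm_setAverage_sub_setAverage_le {α E : Type*} [MeasurableSpace α] {μ : Measure α}
    [NormedAddCommGroup E] [NormedSpace ℝ E] [CompleteSpace E] {P Q : Set α}
    (hPQ : P ⊆ Q) (hP0 : μ P ≠ 0) (hQ : μ Q ≠ ∞) {g : α → E} (hg : IntegrableOn g Q μ) :
    ‖(⨍ x in P, g x ∂μ) - ⨍ x in Q, g x ∂μ‖ₑ ≤
      (μ P)⁻¹ * ((μ Q)⁻¹ * ∫⁻ x in Q, ∫⁻ y in Q, ‖g x - g y‖ₑ ∂μ ∂μ) := by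
  have avg_le : ∀ {S : Set α} (c : E), μ S ≠ 0 → μ S ≠ ∞ → IntegrableOn g S μ →
      ‖(⨍ x in S, g x ∂μ) - c‖ₑ ≤ (μ S)⁻¹ * ∫⁻ x in S, ‖g x - c‖ₑ ∂μ := by
    intro S c h0 h1 hi
    have : (⨍ x in S, g x ∂μ) - c = ⨍ x in S, (g x - c) ∂μ := by
      rw [setAverage_eq, setAverage_eq, integral_sub hi (integrableOn_const h1), smul_sub,
        setIntegral_const, smul_smul, inv_mul_cancel₀, one_smul]
      exact (ENNReal.toReal_pos h0 h1).ne'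
    rw [this, setAverage_eq, enorm_smul, Real.enorm_eq_ofReal (by positivity), Measure.real,
      ← ENNReal.toReal_inv, ENNReal.ofReal_toReal (by simpa using h0)]
    gcongr
    exact enorm_integral_le_lintegral_enorm _
  have hQ0 : μ Q ≠ 0 := fun h => hP0 (measure_mono_null hPQ h)
  refine (avg_le _ hP0 (ne_top_of_le_ne_top hQ (measure_mono hPQ)) (hg.mono_set hPQ)).trans ?_
  gcongr
  calc ∫⁻ x in P, ‖g x - ⨍ y in Q, g y ∂μ‖ₑ ∂μ
      ≤ ∫⁻ x in Q, ‖g x - ⨍ y in Q, g y ∂μ‖ₑ ∂μ := lintegral_mono_set hPQ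
    _ ≤ ∫⁻ x in Q, (μ Q)⁻¹ * ∫⁻ y in Q, ‖g x - g y‖ₑ ∂μ ∂μ := by
        refine lintegral_mono fun x => ?_
        rw [enorm_sub_rev]
        refine (avg_le (g x) hQ0 hQ hg).trans_eq ?_
        simp only [enorm_sub_rev]
    _ = (μ Q)⁻¹ * ∫⁻ x in Q, ∫⁻ y in Q, ‖g x - g y‖ₑ ∂μ ∂μ := by
        rw [lintegral_const_mul' _ _ (by simpa using hQ0)]

lemma sum_min_geometric_le {ρ : ℝ} (hρ : 0 ≤ ρ) (n : ℕ) {r : ℝ} (hr : 0 < r) :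
    ∑ i ∈ Finset.range n, min (r / 2 ^ i) (ρ ^ 2 / (r / 2 ^ i)) ≤ 4 * ρ := by
  suffices H : ∀ (n : ℕ) (r : ℝ), 0 < r →
      (r ≤ ρ → ∑ i ∈ Finset.range n, min (r / 2 ^ i) (ρ ^ 2 / (r / 2 ^ i)) ≤ 2 * r) ∧
      (ρ < r → ∑ i ∈ Finset.range n, min (r / 2 ^ i) (ρ ^ 2 / (r / 2 ^ i)) ≤
        4 * ρ - ρ ^ 2 / r) by
    rcases le_or_gt r ρ with h | h
    · linarith [(H n r hr).1 h]
    · have : 0 ≤ ρ ^ 2 / r := by positivity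
      linarith [(H n r hr).2 h]
  intro n
  induction n with
  | zero =>
    intro r hr
    refine ⟨fun _ => by simpa using hr.le, fun h => ?_⟩
    have : ρ ^ 2 / r ≤ ρ := by
      rw [div_le_iff₀ hr]
      nlinarith
    simp only [Finset.range_zero, Finset.sum_empty]
    linarith
  | succ n ih =>
    intro r hr
    have hshift : ∑ i ∈ Finset.range (n + 1), min (r / 2 ^ i) (ρ ^ 2 / (r / 2 ^ i)) =
        ∑ i ∈ Finset.range n, min ((r / 2) / 2 ^ i) (ρ ^ 2 / ((r / 2) / 2 ^ i)) +
          min r (ρ ^ 2 / r) := by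
      rw [Finset.sum_range_succ']
      simp only [pow_zero, div_one]
      congr 1
      refine Finset.sum_congr rfl fun i _ => ?_
      rw [pow_succ', div_div]
    rw [hshift]
    obtain ⟨h1, h2⟩ := ih (r / 2) (by positivity)
    refine ⟨fun h => ?_, fun h => ?_⟩
    · linarith [h1 (by linarith), min_le_left r (ρ ^ 2 / r)]
    · have hm := min_le_right r (ρ ^ 2 / r)
      rcases le_or_gt (r / 2) ρ with h' | h'
      · have h3 := h1 h'
        have : ρ ^ 2 / r + ρ ^ 2 / r + r ≤ 4 * ρ := by
          rw [← add_div, ← le_sub_iff_add_le, div_le_iff₀ hr]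
          nlinarith
        linarith
      · have h3 := h2 h'
        have : ρ ^ 2 / (r / 2) = 2 * (ρ ^ 2 / r) := by
          field_simp
        linarith

lemma tsum_pow_mul_le_rpow {k : ℕ} (hk : 2 ≤ k) (N : ℕ) {a : ℝ≥0∞} {v : ℕ → ℝ≥0∞}
    (h1 : ∀ i, v i ≤ a) (h2 : ∀ i, v i ≤ (2 ^ ((N + i) * k))⁻¹) :
    ∑' i, 2 ^ ((N + i) * (k - 1)) * v i ≤ 4 * a ^ (1 / (k : ℝ)) := by
  have hk0 : (0 : ℝ) < k := by positivity
  rcases eq_or_ne a ∞ with rfl | ha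
  · rw [ENNReal.top_rpow_of_pos (by positivity), ENNReal.mul_top (by norm_num)]
    exact le_top
  set ρ : ℝ := a.toReal ^ (1 / (k : ℝ)) with hρ
  have hρ0 : 0 ≤ ρ := by positivity
  have hρk : ρ ^ k = a.toReal := by
    rw [hρ, ← Real.rpow_natCast, ← Real.rpow_mul ENNReal.toReal_nonneg,
      one_div_mul_cancel hk0.ne', Real.rpow_one]
  have hρa : a ^ (1 / (k : ℝ)) = ENNReal.ofReal ρ := by
    rw [hρ, ← ENNReal.ofReal_rpow_of_nonneg ENNReal.toReal_nonneg (by positivity),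
      ENNReal.ofReal_toReal ha]
  set r : ℝ := (2 ^ N)⁻¹ with hr
  have hr0 : 0 < r := by positivity
  have hri : ∀ i, r / 2 ^ i = (2 ^ (N + i))⁻¹ := fun i => by
    rw [hr, pow_add, mul_inv]
    rfl
  obtain ⟨l, rfl⟩ : ∃ l, k = l + 2 := ⟨k - 2, by omega⟩
  have hterm : ∀ i, 2 ^ ((N + i) * (l + 2 - 1)) * v i ≤
      ENNReal.ofReal (min (r / 2 ^ i) (ρ ^ 2 / (r / 2 ^ i))) := by
    intro i
    have hv : v i ≠ ∞ := ne_top_of_le_ne_top ha (h1 i)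
    have hs0 : 0 < r / 2 ^ i := by positivity
    have e1 : (2 : ℝ) ^ ((N + i) * (l + 1)) = ((r / 2 ^ i) ^ (l + 1))⁻¹ := by
      rw [hri, inv_pow, inv_inv, pow_mul]
    have e2 : (v i).toReal ≤ (r / 2 ^ i) ^ (l + 2) := by
      have := ENNReal.toReal_mono (by simp) (h2 i)
      refine this.trans_eq ?_
      rw [hri, inv_pow, ← pow_mul]
      simp
    have e3 : (v i).toReal ≤ ρ ^ (l + 2) := by
      rw [hρk]
      exact ENNReal.toReal_mono ha (h1 i)
    have : (2 : ℝ≥0∞) ^ ((N + i) * (l + 2 - 1)) * v i =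
        ENNReal.ofReal (((r / 2 ^ i) ^ (l + 1))⁻¹ * (v i).toReal) := by
      rw [ENNReal.ofReal_mul (by positivity), ENNReal.ofReal_toReal hv, ← e1,
        ENNReal.ofReal_pow (by norm_num)]
      simp
    rw [this]
    set s := r / 2 ^ i
    refine ENNReal.ofReal_le_ofReal ?_
    have b1 : (s ^ (l + 1))⁻¹ * (v i).toReal ≤ s := by
      rw [inv_mul_le_iff₀ (by positivity), ← pow_succ]
      exact e2
    refine le_min b1 ?_
    rcases le_or_gt s ρ with h | h
    · refine b1.trans ?_
      rw [le_div_iff₀ hs0]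
      nlinarith
    · rw [inv_mul_le_iff₀ (by positivity), mul_div_assoc', le_div_iff₀ hs0]
      calc (v i).toReal * s ≤ ρ ^ (l + 2) * s := by gcongr
        _ = ρ ^ l * (ρ ^ 2 * s) := by ring
        _ ≤ s ^ l * (ρ ^ 2 * s) := by gcongr
        _ = _ := by ring
  refine ENNReal.tsum_le_of_sum_range_le fun n => ?_
  calc _ ≤ ∑ i ∈ Finset.range n, ENNReal.ofReal (min (r / 2 ^ i) (ρ ^ 2 / (r / 2 ^ i))) :=
        Finset.sum_le_sum fun i _ => hterm i
    _ = ENNReal.ofReal (∑ i ∈ Finset.range n, min (r / 2 ^ i) (ρ ^ 2 / (r / 2 ^ i))) :=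
        (ENNReal.ofReal_sum_of_nonneg fun i _ => by positivity).symm
    _ ≤ ENNReal.ofReal (4 * ρ) := ENNReal.ofReal_le_ofReal (sum_min_geometric_le hρ0 n hr0)
    _ = _ := by rw [ENNReal.ofReal_mul (by norm_num), hρa]; norm_num

/-- Telescoping over the dyadic cubes that shrink to `x`. -/
lemma edist_average_dyadicCube_le {k : ℕ} (hk : 2 ≤ k) {E : Type*} [NormedAddCommGroup E]
    [NormedSpace ℝ E] [CompleteSpace E] {V : Set (Fin k → ℝ)}
    {g : (Fin k → ℝ) → E} (hg : ContinuousOn g V) {h : (Fin k → ℝ) → ℝ≥0∞} {C : ℝ≥0∞}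
    (hP : ∀ N a, dyadicCube N a ⊆ V →
      ∫⁻ x in dyadicCube N a, ∫⁻ y in dyadicCube N a, ‖g x - g y‖ₑ ≤
        C * (2 ^ N)⁻¹ * (2 ^ (N * k))⁻¹ * ∫⁻ x in dyadicCube N a, h x)
    (N : ℕ) (x : Fin k → ℝ) (hV : dyadicCube N (dyadicIndex N x) ⊆ V) :
    edist (⨍ y in dyadicCube N (dyadicIndex N x), g y) (g x) ≤
      C * 2 ^ k * ∑' i, 2 ^ ((N + i) * (k - 1)) *
        ∫⁻ y in dyadicCube (N + i) (dyadicIndex (N + i) x), h y := by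
  set Q : ℕ → Set (Fin k → ℝ) := fun i => dyadicCube (N + i) (dyadicIndex (N + i) x) with hQ
  have hQsucc : ∀ i, Q (i + 1) ⊆ Q i := fun i => dyadicCube_succ_subset (N + i) x
  have hQ0 : ∀ i, Q i ⊆ Q 0 := fun i => by
    induction i with
    | zero => exact subset_rfl
    | succ i ih => exact (hQsucc i).trans ih
  have hQV : ∀ i, Q i ⊆ V := fun i => (hQ0 i).trans hV
  have hvol : ∀ i, volume (Q i) = ((2 : ℝ≥0∞) ^ ((N + i) * k))⁻¹ := fun i =>
    volume_dyadicCube _ _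
  have hcomp : ∀ i, IsCompact (Q i) := fun i => isCompact_dyadicCube _ _
  have hint : ∀ i, IntegrableOn g (Q i) := fun i =>
    (hg.mono (hQV i)).integrableOn_compact (hcomp i)
  have hv0 : ∀ i, volume (Q i) ≠ 0 := fun i => by simp [hvol]
  have hvt : ∀ i, volume (Q i) ≠ ∞ := fun i => (hcomp i).measure_lt_top.ne
  have hxQ : ∀ i, x ∈ Q i := fun i => mem_dyadicCube_dyadicIndex _ _
  rw [← ENNReal.tsum_mul_left]
  refine edist_le_tsum_of_edist_le_of_tendsto₀
    (f := fun i => ⨍ y in Q i, g y) _ (fun i => ?_) ?_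
  · rw [edist_comm, edist_eq_enorm_sub]
    refine (enorm_setAverage_sub_setAverage_le (hQsucc i) (hv0 _) (hvt _) (hint i)).trans ?_
    have := hP (N + i) _ (hQV i)
    calc _ ≤ (volume (Q (i + 1)))⁻¹ * ((volume (Q i))⁻¹ *
          (C * (2 ^ (N + i))⁻¹ * (2 ^ ((N + i) * k))⁻¹ * ∫⁻ x in Q i, h x)) := by gcongr
      _ = (volume (Q (i + 1)))⁻¹ * (((volume (Q i))⁻¹ * (2 ^ ((N + i) * k))⁻¹) *
          (C * (2 ^ (N + i))⁻¹ * ∫⁻ x in Q i, h x)) := by ring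
      _ = 2 ^ k * (2 ^ ((N + i) * (k - 1)) * (2 ^ (N + i) * (2 ^ (N + i))⁻¹)) *
          (C * ∫⁻ x in Q i, h x) := by
        rw [hvol, hvol, inv_inv, inv_inv, ENNReal.mul_inv_cancel (by simp) (by simp), one_mul]
        obtain ⟨l, rfl⟩ : ∃ l, k = l + 1 := ⟨k - 1, by omega⟩
        rw [Nat.add_sub_cancel]
        ring
      _ = _ := by
        rw [ENNReal.mul_inv_cancel (by simp) (by simp), mul_one]
        ring
  · rw [Metric.tendsto_atTop]
    intro ε hε
    have hcw : ContinuousWithinAt g (Q 0) x := (hg.mono (hQV 0)) x (hxQ 0)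
    obtain ⟨δ, hδ, hgδ⟩ := Metric.continuousWithinAt_iff.1 hcw (ε / 2) (by positivity)
    obtain ⟨M, hM⟩ := exists_pow_lt_of_lt_one hδ (show (1 / 2 : ℝ) < 1 by norm_num)
    refine ⟨M, fun i hi => ?_⟩
    have hmem : (⨍ y in Q i, g y) ∈ closedBall (g x) (ε / 2) := by
      refine (convex_closedBall _ _).set_average_mem isClosed_closedBall (hv0 i) (hvt i) ?_ (hint i)
      refine (ae_restrict_mem (hcomp i).measurableSet).mono fun y hy => ?_
      refine (hgδ (hQ0 i hy) ?_).le
      have := dyadicCube_subset_closedBall (hxQ i) hy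
      refine (mem_closedBall.1 this).trans_lt (lt_of_le_of_lt ?_ hM)
      exact pow_le_pow_of_le_one (by norm_num) (by norm_num) (by omega)
    exact (mem_closedBall.1 hmem).trans_lt (by linarith)

lemma tsum_pow_mul_rpow_le {k : ℕ} (hk : 2 ≤ k) {w μ v : ℕ → ℝ≥0∞} (hw0 : ∀ j, w j ≠ 0)
    (hwt : ∀ j, w j ≠ ∞) (hv : ∀ j, w j * v j ≤ μ j) :
    ∑' j, 2 ^ j * v j ^ (1 / (k : ℝ)) ≤ (∑' j, μ j) ^ (1 / (k : ℝ)) *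
      (∑' j, 2 ^ j * (2 ^ j / w j) ^ (1 / ((k : ℝ) - 1))) ^ (((k : ℝ) - 1) / k) := by
  have hk1 : (1 : ℝ) < k := by exact_mod_cast hk
  have hconj := Real.HolderConjugate.conjExponent hk1
  have hq : Real.conjExponent k = (k : ℝ) / (k - 1) := rfl
  have hkm : (0 : ℝ) < (k : ℝ) - 1 := by linarith
  have hk0 : (0 : ℝ) < k := by linarith
  have key := ENNReal.lintegral_mul_le_Lp_mul_Lq (Measure.count (α := ℕ)) hconj
    (f := fun j => μ j ^ (1 / (k : ℝ)))
    (g := fun j => 2 ^ j * (w j)⁻¹ ^ (1 / (k : ℝ)))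
    (measurable_of_countable _).aemeasurable (measurable_of_countable _).aemeasurable
  simp only [lintegral_count, Pi.mul_apply] at key
  have e1 : ∀ j, (μ j ^ (1 / (k : ℝ))) ^ (k : ℝ) = μ j := fun j => by
    rw [← ENNReal.rpow_mul, one_div_mul_cancel hk0.ne', ENNReal.rpow_one]
  have e2 : ∀ j, ((2 : ℝ≥0∞) ^ j * (w j)⁻¹ ^ (1 / (k : ℝ))) ^ Real.conjExponent (k : ℝ) =
      2 ^ j * (2 ^ j / w j) ^ (1 / ((k : ℝ) - 1)) := fun j => by
    have h1 : (k : ℝ) / (k - 1) = 1 + 1 / (k - 1) := by field_simp; ring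
    have h2 : 1 / (k : ℝ) * (k / (k - 1)) = 1 / (k - 1) := by field_simp
    rw [hq, ENNReal.mul_rpow_of_nonneg _ _ (by positivity), ← ENNReal.rpow_mul, h2, h1,
      ENNReal.rpow_add _ _ (by simp) (by simp), ENNReal.rpow_one, div_eq_mul_inv (2 ^ j) (w j),
      ENNReal.mul_rpow_of_nonneg _ _ (by positivity), mul_assoc]
  simp only [e1, e2] at key
  have e3 : 1 / Real.conjExponent (k : ℝ) = ((k : ℝ) - 1) / k := by rw [hq, one_div_div]
  rw [e3] at key
  refine le_trans (ENNReal.tsum_le_tsum fun j => ?_) key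
  rw [mul_left_comm]
  gcongr
  rw [← ENNReal.mul_rpow_of_nonneg _ _ (by positivity)]
  gcongr
  rw [← div_eq_mul_inv, ENNReal.le_div_iff_mul_le (Or.inl (hw0 j)) (Or.inl (hwt j)), mul_comm]
  exact hv j

/-- Oscillation estimate on dyadic cubes: `(osc_Q g)ᵏ` is controlled by the integral of `Ψ`. -/
lemma ediam_image_dyadicCube_rpow_le {k : ℕ} (hk : 2 ≤ k) {E : Type*} [NormedAddCommGroup E]
    [NormedSpace ℝ E] [CompleteSpace E] {V : Set (Fin k → ℝ)}
    {g : (Fin k → ℝ) → E} (hg : ContinuousOn g V) {u Ψ : (Fin k → ℝ) → ℝ≥0∞} {C : ℝ≥0∞}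
    (hP : ∀ N a, dyadicCube N a ⊆ V →
      ∫⁻ x in dyadicCube N a, ∫⁻ y in dyadicCube N a, ‖g x - g y‖ₑ ≤
        C * (2 ^ N)⁻¹ * (2 ^ (N * k))⁻¹ * ∫⁻ x in dyadicCube N a, u x)
    {A : ℕ → Set (Fin k → ℝ)} (hA : ∀ j, MeasurableSet (A j))
    (hAd : Pairwise (Function.onFun Disjoint A))
    (huA : ∀ x, u x ≤ ∑' j, (A j).indicator (fun _ => 2 ^ (j + 1)) x)
    {w : ℕ → ℝ≥0∞} (hw0 : ∀ j, w j ≠ 0) (hwt : ∀ j, w j ≠ ∞)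
    (hΨ : ∀ j, ∀ x ∈ A j, w j ≤ Ψ x)
    (N : ℕ) (a : Fin k → ℤ) (hV : dyadicCube N a ⊆ V) {B : Set (Fin k → ℝ)}
    (hB : ∀ x ∈ B, dyadicIndex N x = a) :
    ediam (g '' B) ^ (k : ℝ) ≤ (C * 2 ^ k * 16) ^ (k : ℝ) *
      (∑' j, 2 ^ j * (2 ^ j / w j) ^ (1 / ((k : ℝ) - 1))) ^ ((k : ℝ) - 1) *
        ∫⁻ x in dyadicCube N a, Ψ x := by
  set M := ∑' j, (2 : ℝ≥0∞) ^ j * (2 ^ j / w j) ^ (1 / ((k : ℝ) - 1)) with hM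
  set Q := dyadicCube N a with hQ
  have hQm : MeasurableSet Q := measurableSet_dyadicCube N a
  have hk0 : (0 : ℝ) < k := by positivity
  have hμ : ∑' j, ∫⁻ x in A j ∩ Q, Ψ x ≤ ∫⁻ x in Q, Ψ x := by
    rw [← lintegral_iUnion (fun j => (hA j).inter hQm)
      (hAd.mono fun i j h => h.mono inter_subset_left inter_subset_left)]
    exact lintegral_mono_set (iUnion_subset fun j => inter_subset_right)
  have hv : ∀ j, w j * volume (A j ∩ Q) ≤ ∫⁻ x in A j ∩ Q, Ψ x := fun j => by
    rw [← setLIntegral_const]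
    exact setLIntegral_mono' ((hA j).inter hQm) fun x hx => hΨ j x hx.1
  have hS : ∀ x ∈ B, edist (⨍ y in Q, g y) (g x) ≤
      C * 2 ^ k * 8 * ((∫⁻ x in Q, Ψ x) ^ (1 / (k : ℝ)) * M ^ (((k : ℝ) - 1) / k)) := by
    intro x hx
    have hxa := hB x hx
    have h1 := edist_average_dyadicCube_le hk hg hP N x (by rw [hxa]; exact hV)
    rw [hxa] at h1
    refine h1.trans ?_
    rw [mul_assoc (C * 2 ^ k) 8]
    gcongr
    set R : ℕ → Set (Fin k → ℝ) := fun i => dyadicCube (N + i) (dyadicIndex (N + i) x) with hR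
    have hRm : ∀ i, MeasurableSet (R i) := fun i => measurableSet_dyadicCube _ _
    have hRQ : ∀ i, R i ⊆ Q := fun i => by
      induction i with
      | zero => simp only [hR, Nat.add_zero, hxa]; exact subset_rfl
      | succ i ih => exact (dyadicCube_succ_subset (N + i) x).trans ih
    calc ∑' i, 2 ^ ((N + i) * (k - 1)) * ∫⁻ y in R i, u y
        ≤ ∑' i, 2 ^ ((N + i) * (k - 1)) * ∑' j, 2 ^ (j + 1) * volume (A j ∩ R i) := by
          gcongr with i
          calc ∫⁻ y in R i, u y
              ≤ ∫⁻ y in R i, ∑' j, (A j).indicator (fun _ => 2 ^ (j + 1)) y :=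
                lintegral_mono fun y => huA y
            _ = ∑' j, 2 ^ (j + 1) * volume (A j ∩ R i) := by
                rw [lintegral_tsum fun j => (measurable_const.indicator (hA j)).aemeasurable]
                refine tsum_congr fun j => ?_
                rw [lintegral_indicator_const (hA j), Measure.restrict_apply (hA j)]
      _ = ∑' j, 2 ^ (j + 1) * ∑' i, 2 ^ ((N + i) * (k - 1)) * volume (A j ∩ R i) := by
          simp only [← ENNReal.tsum_mul_left]
          rw [ENNReal.tsum_comm]
          simp only [mul_left_comm]
      _ ≤ ∑' j, 2 ^ (j + 1) * (4 * volume (A j ∩ Q) ^ (1 / (k : ℝ))) := by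
          gcongr with j
          refine tsum_pow_mul_le_rpow hk N (fun i => ?_) (fun i => ?_)
          · exact measure_mono (inter_subset_inter_right _ (hRQ i))
          · exact (measure_mono inter_subset_right).trans_eq (volume_dyadicCube _ _)
      _ = 8 * ∑' j, 2 ^ j * volume (A j ∩ Q) ^ (1 / (k : ℝ)) := by
          rw [← ENNReal.tsum_mul_left]
          refine tsum_congr fun j => ?_
          rw [pow_succ]
          ring
      _ ≤ 8 * ((∑' j, ∫⁻ x in A j ∩ Q, Ψ x) ^ (1 / (k : ℝ)) * M ^ (((k : ℝ) - 1) / k)) := by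
          gcongr
          exact tsum_pow_mul_rpow_le hk hw0 hwt hv
      _ ≤ _ := by gcongr
  set D := C * 2 ^ k * 8 * ((∫⁻ x in Q, Ψ x) ^ (1 / (k : ℝ)) * M ^ (((k : ℝ) - 1) / k)) with hD
  have hdiam : ediam (g '' B) ≤ 2 * D := by
    refine ediam_le ?_
    rintro _ ⟨x, hx, rfl⟩ _ ⟨y, hy, rfl⟩
    refine (edist_triangle_left _ _ (⨍ y in Q, g y)).trans ?_
    rw [two_mul]
    exact add_le_add (hS x hx) (hS y hy)
  calc ediam (g '' B) ^ (k : ℝ) ≤ (2 * D) ^ (k : ℝ) := by gcongr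
    _ = ((C * 2 ^ k * 16) * ((∫⁻ x in Q, Ψ x) ^ (1 / (k : ℝ)) *
          M ^ (((k : ℝ) - 1) / k))) ^ (k : ℝ) := by
        congr 1
        rw [hD, ← mul_assoc, mul_left_comm 2]
        norm_num
    _ = _ := by
        generalize C * 2 ^ k * 16 = c
        rw [ENNReal.mul_rpow_of_nonneg _ _ hk0.le, ENNReal.mul_rpow_of_nonneg _ _ hk0.le,
          ← ENNReal.rpow_mul, ← ENNReal.rpow_mul, one_div_mul_cancel hk0.ne',
          div_mul_cancel₀ _ hk0.ne', ENNReal.rpow_one]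
        ring

/-- If the `d`-th powers of the oscillations of `g` on dyadic cubes are controlled by the integral
of `Ψ`, then the Hausdorff measure of the image of an open set is as well. -/
lemma hausdorffMeasure_image_isOpen_le {k : ℕ} (hk : 0 < k) {E : Type*} [EMetricSpace E]
    [MeasurableSpace E] [BorelSpace E] {d : ℝ} (hd : 0 < d) {V W : Set (Fin k → ℝ)}
    {g : (Fin k → ℝ) → E} {Ψ : (Fin k → ℝ) → ℝ≥0∞} {c : ℝ≥0∞} (hc : c ≠ ∞)
    (hosc : ∀ N a, dyadicCube N a ⊆ V → ∀ B : Set (Fin k → ℝ), (∀ x ∈ B, dyadicIndex N x = a) →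
      ediam (g '' B) ^ d ≤ c * ∫⁻ x in dyadicCube N a, Ψ x)
    (hW : IsOpen W) (hWV : W ⊆ V) (hfin : ∫⁻ x in W, Ψ x ≠ ∞) :
    μH[d] (g '' W) ≤ c * ∫⁻ x in W, Ψ x := by
  set T : ℕ → Set (Fin k → ℝ) := fun N => {x | closedBall x ((1 / 2) ^ N) ⊆ W} with hT
  have hTmono : Monotone T := fun N M hNM x hx =>
    (closedBall_subset_closedBall
      (pow_le_pow_of_le_one (by norm_num) (by norm_num) hNM)).trans hx
  have hTW : W = ⋃ N, T N := by
    refine Subset.antisymm (fun x hx => ?_) (iUnion_subset fun N x hx => hx (mem_closedBall_self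
      (by positivity)))
    obtain ⟨ε, hε, hεW⟩ := Metric.isOpen_iff.1 hW x hx
    obtain ⟨N, hN⟩ := exists_pow_lt_of_lt_one hε (show (1 / 2 : ℝ) < 1 by norm_num)
    exact mem_iUnion.2 ⟨N, (closedBall_subset_ball hN).trans hεW⟩
  have hmono : Monotone fun N => g '' T N := fun N M h => image_mono (hTmono h)
  have hcover : g '' W = ⋃ N, g '' T N := by rw [← image_iUnion, ← hTW]
  rw [hcover, hmono.measure_iUnion]
  refine iSup_le fun N => ?_
  set S : ℕ → Set (Fin k → ℤ) := fun n => {a | dyadicCube n a ⊆ W} with hS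
  have hsmall : Filter.Tendsto
      (fun n : ℕ => ⨆ a : S n, (c * ∫⁻ x in dyadicCube n a.1, Ψ x) ^ (1 / d))
      Filter.atTop (𝓝 0) := by
    rw [ENNReal.tendsto_atTop_zero]
    intro ε hε
    have hε' : 0 < ε ^ d / c := by
      refine ENNReal.div_pos (by simp [hε.ne', hd.le]) hc
    obtain ⟨δ, hδ, hδΨ⟩ := exists_pos_setLIntegral_lt_of_measure_lt hfin hε'.ne'
    have ht : Filter.Tendsto (fun n : ℕ => ((2 : ℝ≥0∞) ^ (n * k))⁻¹) Filter.atTop (𝓝 0) := by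
      have : Filter.Tendsto (fun n : ℕ => ((2 : ℝ≥0∞)⁻¹) ^ (n * k)) Filter.atTop (𝓝 0) :=
        (ENNReal.tendsto_pow_atTop_nhds_zero_of_lt_one (by simp)).comp
          (Filter.tendsto_id.atTop_mul_const' hk)
      simpa only [ENNReal.inv_pow] using this
    obtain ⟨n₀, hn₀⟩ := Filter.eventually_atTop.1 ((tendsto_order.1 ht).2 δ hδ)
    refine ⟨n₀, fun n hn => iSup_le fun a => ?_⟩
    rw [one_div, ENNReal.rpow_inv_le_iff hd, mul_comm]
    refine ENNReal.mul_le_of_le_div (le_of_lt ?_)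
    have := hδΨ (dyadicCube n a.1) ?_
    · rwa [Measure.restrict_restrict (measurableSet_dyadicCube _ _),
        inter_eq_self_of_subset_left a.2] at this
    · rw [Measure.restrict_apply (measurableSet_dyadicCube _ _),
        inter_eq_self_of_subset_left a.2, volume_dyadicCube]
      exact hn₀ n hn
  have hbd : ∀ n (a : S n), ediam (g '' {x | dyadicIndex n x = a.1}) ^ d ≤
      c * ∫⁻ x in dyadicCube n a.1, Ψ x := fun n a =>
    hosc n a.1 (a.2.trans hWV) _ fun x hx => hx
  refine (Measure.hausdorffMeasure_le_liminf_tsum d (g '' T N) (l := Filter.atTop) _ hsmall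
    (fun n (a : S n) => g '' {x | dyadicIndex n x = a.1}) (.of_forall fun n a => ?_) ?_).trans ?_
  · refine le_trans ?_ (le_iSup _ a)
    rw [one_div, ENNReal.le_rpow_inv_iff hd]
    exact hbd n a
  · refine Filter.eventually_atTop.2 ⟨N, fun n hn => ?_⟩
    rintro _ ⟨x, hx, rfl⟩
    refine mem_iUnion.2 ⟨⟨dyadicIndex n x, ?_⟩, mem_image_of_mem g rfl⟩
    exact (dyadicCube_subset_closedBall (mem_dyadicCube_dyadicIndex n x)).trans (hTmono hn hx)
  · refine Filter.liminf_le_of_le (by isBoundedDefault) fun b hb => ?_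
    obtain ⟨n, hn⟩ := hb.exists
    calc b ≤ _ := hn
      _ ≤ ∑' a : S n, c * ∫⁻ x in dyadicCube n a.1, Ψ x := ENNReal.tsum_le_tsum fun a => hbd n a
      _ ≤ _ := by
        rw [ENNReal.tsum_mul_left]
        gcongr
        exact tsum_setLIntegral_dyadicCube_le n W (S n) (fun a ha => ha) Ψ

/-- Version of `hausdorffMeasure_image_isOpen_le` for arbitrary subsets, where the integral of `Ψ`
is interpreted as an outer measure. -/
lemma hausdorffMeasure_image_le_withDensity {k : ℕ} (hk : 0 < k) {E : Type*} [EMetricSpace E]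
    [MeasurableSpace E] [BorelSpace E] {d : ℝ} (hd : 0 < d) {V W : Set (Fin k → ℝ)}
    {g : (Fin k → ℝ) → E} {Ψ : (Fin k → ℝ) → ℝ≥0∞} {c : ℝ≥0∞} (hc : c ≠ ∞)
    (hosc : ∀ N a, dyadicCube N a ⊆ V → ∀ B : Set (Fin k → ℝ), (∀ x ∈ B, dyadicIndex N x = a) →
      ediam (g '' B) ^ d ≤ c * ∫⁻ x in dyadicCube N a, Ψ x)
    (hW : IsOpen W) (hWV : W ⊆ V) (hfin : ∫⁻ x in W, Ψ x ≠ ∞) {S : Set (Fin k → ℝ)}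
    (hS : S ⊆ W) :
    μH[d] (g '' S) ≤ c * (volume.restrict W).withDensity Ψ S := by
  set ν := (volume.restrict W).withDensity Ψ with hν
  have : IsFiniteMeasure ν := isFiniteMeasure_withDensity hfin
  refine le_of_forall_gt_imp_ge_of_dense fun b hb => ?_
  obtain ⟨r, hr, hrb⟩ : ∃ r, ν S < r ∧ c * r ≤ b := by
    rcases eq_or_ne c 0 with rfl | hc0
    · exact ⟨ν S + 1, ENNReal.lt_add_right (measure_ne_top _ _) one_ne_zero, by simp⟩
    · refine ⟨b / c, ?_, ENNReal.mul_div_le⟩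
      rwa [ENNReal.lt_div_iff_mul_lt (Or.inl hc0) (Or.inl hc), mul_comm]
  obtain ⟨O, hSO, hO, hOr⟩ := Set.exists_isOpen_lt_of_lt S r hr
  have hOW : IsOpen (O ∩ W) := hO.inter hW
  calc μH[d] (g '' S) ≤ μH[d] (g '' (O ∩ W)) := by
        gcongr
        exact subset_inter hSO hS
    _ ≤ c * ∫⁻ x in O ∩ W, Ψ x :=
        hausdorffMeasure_image_isOpen_le hk hd hc hosc hOW (inter_subset_right.trans hWV)
          (ne_top_of_le_ne_top hfin (lintegral_mono_set inter_subset_right))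
    _ = c * ν O := by
        rw [hν, withDensity_apply _ hO.measurableSet, Measure.restrict_restrict hO.measurableSet]
    _ ≤ b := (mul_le_mul_right hOr.le c).trans hrb

/-- The dyadic sum version of the Calderón condition. -/
lemma tsum_dyadic_ne_top_of_setLIntegral {φ : ℝ → ℝ} (hφ : MonotoneOn φ (Ici 0)) {p : ℝ}
    (hp : 0 ≤ p)
    (hI : ∫⁻ t in Ioi (1 : ℝ), (ENNReal.ofReal t / ENNReal.ofReal (φ t)) ^ p ≠ ∞) :
    ∑' j : ℕ, (2 : ℝ≥0∞) ^ (j + 1) * (2 ^ (j + 1) / ENNReal.ofReal (φ (2 ^ (j + 1)))) ^ p ≠ ∞ := by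
  set F : ℝ → ℝ≥0∞ := fun t => (ENNReal.ofReal t / ENNReal.ofReal (φ t)) ^ p with hF
  set J : ℕ → Set ℝ := fun j => Ioc (2 ^ j) (2 ^ (j + 1)) with hJ
  have hmono : Monotone fun j : ℕ => (2 : ℝ) ^ j := pow_right_mono₀ (by norm_num)
  have hJd : Pairwise (Function.onFun Disjoint J) := hmono.pairwise_disjoint_on_Ioc_succ
  have hJs : ⋃ j, J j ⊆ Ioi (1 : ℝ) := iUnion_subset fun j t ht =>
    lt_of_le_of_lt (one_le_pow₀ (by norm_num)) ht.1
  have hterm : ∀ j : ℕ, (2 : ℝ≥0∞) ^ (j + 1) *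
      (2 ^ (j + 1) / ENNReal.ofReal (φ (2 ^ (j + 1)))) ^ p ≤ (2 * 2 ^ p) * ∫⁻ t in J j, F t := by
    intro j
    have h1 : ∫⁻ _ in J j, (2 ^ j / ENNReal.ofReal (φ (2 ^ (j + 1)))) ^ p ≤ ∫⁻ t in J j, F t := by
      refine setLIntegral_mono' measurableSet_Ioc fun t ht => ?_
      have h0 : (0 : ℝ) ≤ 2 ^ j := by positivity
      refine ENNReal.rpow_le_rpow (ENNReal.div_le_div ?_ (ENNReal.ofReal_le_ofReal ?_)) hp
      · rw [← ENNReal.ofReal_ofNat, ← ENNReal.ofReal_pow (by norm_num)]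
        exact ENNReal.ofReal_le_ofReal ht.1.le
      · exact hφ (h0.trans ht.1.le) (show (0 : ℝ) ≤ 2 ^ (j + 1) by positivity) ht.2
    have h2 : volume (J j) = 2 ^ j := by
      rw [hJ, Real.volume_Ioc, pow_succ, show (2 : ℝ) ^ j * 2 - 2 ^ j = 2 ^ j by ring,
        ENNReal.ofReal_pow (by norm_num), ENNReal.ofReal_ofNat]
    rw [setLIntegral_const, h2] at h1
    calc (2 : ℝ≥0∞) ^ (j + 1) * (2 ^ (j + 1) / ENNReal.ofReal (φ (2 ^ (j + 1)))) ^ p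
        = (2 * 2 ^ p) * ((2 ^ j / ENNReal.ofReal (φ (2 ^ (j + 1)))) ^ p * 2 ^ j) := by
          rw [pow_succ (2 : ℝ≥0∞) j, mul_comm ((2 : ℝ≥0∞) ^ j) 2, mul_div_assoc,
            ENNReal.mul_rpow_of_nonneg _ _ hp]
          ring
      _ ≤ _ := by gcongr
  refine ne_top_of_le_ne_top ?_ (ENNReal.tsum_le_tsum hterm)
  rw [ENNReal.tsum_mul_left, ← lintegral_iUnion (fun j => measurableSet_Ioc) hJd]
  exact ENNReal.mul_ne_top (ENNReal.mul_ne_top (by simp) (by simp))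
    (ne_top_of_le_ne_top hI (lintegral_mono_set hJs))

/-- The density that controls the Hausdorff measure of images. -/
def gradDensity (φ : ℝ → ℝ) (s : ℝ) : ℝ≥0∞ := if s = 0 then 0 else 1 + ENNReal.ofReal (φ s)

lemma gradDensity_le (φ : ℝ → ℝ) (s : ℝ) : gradDensity φ s ≤ 1 + ENNReal.ofReal (φ s) := by
  unfold gradDensity
  split_ifs <;> simp

/-- In dimension `k ≥ 2`, a continuous function satisfying the Poincaré inequality on dyadic cubes
with a gradient satisfying the Calderón condition maps sets to sets whose Hausdorff measure is
controlled by the integral of `gradDensity`. -/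
lemma exists_hausdorffMeasure_image_le {k : ℕ} (hk : 2 ≤ k) {E : Type*} [NormedAddCommGroup E]
    [NormedSpace ℝ E] [CompleteSpace E] [MeasurableSpace E] [BorelSpace E]
    {φ : ℝ → ℝ} (hφ : MonotoneOn φ (Ici 0))
    (hI : ∫⁻ t in Ioi (1 : ℝ),
      (ENNReal.ofReal t / ENNReal.ofReal (φ t)) ^ (1 / ((k : ℝ) - 1)) ≠ ∞)
    {V : Set (Fin k → ℝ)} {g : (Fin k → ℝ) → E} (hg : ContinuousOn g V)
    {H : (Fin k → ℝ) → ℝ} (hH : Measurable H) {C : ℝ≥0∞} (hC : C ≠ ∞)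
    (hP : ∀ N a, dyadicCube N a ⊆ V →
      ∫⁻ x in dyadicCube N a, ∫⁻ y in dyadicCube N a, ‖g x - g y‖ₑ ≤
        C * (2 ^ N)⁻¹ * (2 ^ (N * k))⁻¹ * ∫⁻ x in dyadicCube N a, ENNReal.ofReal (H x)) :
    ∃ c : ℝ≥0∞, c ≠ ∞ ∧ ∀ W : Set (Fin k → ℝ), IsOpen W → W ⊆ V →
      ∫⁻ x in W, gradDensity φ (H x) ≠ ∞ → ∀ S ⊆ W,
        μH[(k : ℝ)] (g '' S) ≤ c * (volume.restrict W).withDensity (fun x => gradDensity φ (H x)) S := by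
  have hk1 : (1 : ℝ) < k := by exact_mod_cast hk
  have hp : 0 < 1 / ((k : ℝ) - 1) := one_div_pos.2 (by linarith)
  set p := 1 / ((k : ℝ) - 1)
  have hsum := tsum_dyadic_ne_top_of_setLIntegral hφ hp.le hI
  set w : ℕ → ℝ≥0∞ := fun j => if j = 0 then 1 else ENNReal.ofReal (φ (2 ^ j)) with hw
  set L : ℕ → Set ℝ := fun j => if j = 0 then Ioc 0 2 else Ioc (2 ^ j) (2 ^ (j + 1)) with hL
  have hL' : ∀ j, L j = Ioc (if j = 0 then 0 else 2 ^ j) (2 ^ (j + 1)) := fun j => by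
    rcases eq_or_ne j 0 with rfl | hj
    · simp [hL]
    · simp [hL, hj]
  have hLm : ∀ j, MeasurableSet (L j) := fun j => by rw [hL']; exact measurableSet_Ioc
  have hLd : Pairwise (Function.onFun Disjoint L) := by
    have hmono : Monotone fun j : ℕ => if j = 0 then (0 : ℝ) else 2 ^ j := by
      refine monotone_nat_of_le_succ fun j => ?_
      rcases eq_or_ne j 0 with rfl | hj
      · simp
      · simp only [hj, if_false, Nat.succ_ne_zero]
        exact pow_le_pow_right₀ (by norm_num) (by omega)
    have := hmono.pairwise_disjoint_on_Ioc_succ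
    intro i j hij
    have h := this hij
    simpa [Function.onFun, hL'] using h
  have hw0 : ∀ j, w j ≠ 0 := by
    rintro (_ | j)
    · simp [hw]
    · intro h
      refine ENNReal.ne_top_of_tsum_ne_top hsum j ?_
      simp only [hw, Nat.succ_ne_zero, if_false] at h
      rw [h, ENNReal.div_zero (by simp), ENNReal.top_rpow_of_pos hp, ENNReal.mul_top (by simp)]
  have hwt : ∀ j, w j ≠ ∞ := fun j => by
    rcases eq_or_ne j 0 with rfl | hj
    · simp [hw]
    · simp [hw, hj]
  have hM : ∑' j, (2 : ℝ≥0∞) ^ j * (2 ^ j / w j) ^ p ≠ ∞ := by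
    rw [tsum_eq_zero_add' ENNReal.summable]
    simp only [hw, Nat.succ_ne_zero, if_false, if_true]
    exact ENNReal.add_ne_top.2 ⟨by simp, hsum⟩
  have hosc := fun N a (hV : dyadicCube N a ⊆ V) B hB =>
    ediam_image_dyadicCube_rpow_le hk hg (u := fun x => ENNReal.ofReal (H x))
      (Ψ := fun x => gradDensity φ (H x)) hP (A := fun j => H ⁻¹' L j) (fun j => hH (hLm j))
      (fun i j hij => (hLd hij).preimage H) (fun x => ?_) hw0 hwt (fun j x hx => ?_) N a hV
      (B := B) hB
  · refine ⟨_, ?_, fun W hW hWV hfin S hS => hausdorffMeasure_image_le_withDensity (by omega)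
      (by linarith) ?_ hosc hW hWV hfin hS⟩
    all_goals
      refine ENNReal.mul_ne_top (ENNReal.rpow_ne_top_of_nonneg (by linarith) ?_)
        (ENNReal.rpow_ne_top_of_nonneg (by linarith) hM)
      exact ENNReal.mul_ne_top (ENNReal.mul_ne_top hC (by simp)) (by simp)
  · have key : ∀ j, H x ∈ L j → ENNReal.ofReal (H x) ≤
        ∑' j, (H ⁻¹' L j).indicator (fun _ => (2 : ℝ≥0∞) ^ (j + 1)) x := fun j hj => by
      refine le_trans ?_ (ENNReal.le_tsum j)
      rw [indicator_of_mem (show x ∈ H ⁻¹' L j from hj), ← ENNReal.ofReal_ofNat,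
        ← ENNReal.ofReal_pow (by norm_num)]
      rw [hL'] at hj
      exact ENNReal.ofReal_le_ofReal hj.2
    rcases le_or_gt (H x) 0 with h | h
    · simp [ENNReal.ofReal_of_nonpos h]
    have hex : ∃ j : ℕ, H x ≤ 2 ^ (j + 1) := by
      obtain ⟨n, hn⟩ := pow_unbounded_of_one_lt (H x) (show (1 : ℝ) < 2 by norm_num)
      exact ⟨n, hn.le.trans (pow_le_pow_right₀ (by norm_num) (by omega))⟩
    classical
    refine key (Nat.find hex) ?_
    rw [hL']
    refine ⟨?_, Nat.find_spec hex⟩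
    split_ifs with h0
    · exact h
    · obtain ⟨i, hi⟩ := Nat.exists_eq_succ_of_ne_zero h0
      rw [hi]
      exact not_le.1 (Nat.find_min hex (m := i) (by omega))
  · have hx' : H x ∈ L j := hx
    rcases eq_or_ne j 0 with rfl | hj
    · simp only [hL, if_true] at hx'
      simp [hw, gradDensity, hx'.1.ne']
    · simp only [hL, hj, if_false] at hx'
      have hpos : (0 : ℝ) < 2 ^ j := by positivity
      simp only [hw, hj, if_false, gradDensity, (hpos.trans hx'.1).ne']
      refine le_add_left (ENNReal.ofReal_le_ofReal ?_)
      exact hφ hpos.le (hpos.trans hx'.1).le hx'.1.le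

section Poincare

variable {X : Type*} [NormedAddCommGroup X] [NormedSpace ℝ X] [FiniteDimensional ℝ X]
  [MeasurableSpace X] [BorelSpace X] (μ : Measure X) [μ.IsAddHaarMeasure]

lemma lintegral_comp_homothety {s : ℝ} (hs : 0 < s) (y : X) {u : X → ℝ≥0∞} (hu : Measurable u) :
    ∫⁻ x, u (s • x + y) ∂μ = ENNReal.ofReal ((s ^ Module.finrank ℝ X)⁻¹) * ∫⁻ x, u x ∂μ := by
  have h1 : ∫⁻ x, u (s • x + y) ∂μ = ∫⁻ x, u (x + y) ∂(Measure.map (fun x => s • x) μ) := by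
    rw [lintegral_map (by fun_prop) (by fun_prop)]
  rw [h1, Measure.map_addHaar_smul μ hs.ne', lintegral_smul_measure, lintegral_add_right_eq_self,
    abs_of_pos (by positivity), smul_eq_mul]

lemma setLIntegral_comp_segment_le {Q : Set X} (hQ : MeasurableSet Q) (hconv : Convex ℝ Q)
    {u : X → ℝ≥0∞} (hu : Measurable u) {t : ℝ} (ht : t ∈ Icc (0 : ℝ) (1 / 2)) {y : X} (hy : y ∈ Q) :
    ∫⁻ x in Q, u (x + t • (y - x)) ∂μ ≤ 2 ^ Module.finrank ℝ X * ∫⁻ x in Q, u x ∂μ := by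
  have e : ∀ x : X, x + t • (y - x) = (1 - t) • x + t • y := fun x => by module
  have h1t : 0 < 1 - t := by linarith [ht.2]
  calc ∫⁻ x in Q, u (x + t • (y - x)) ∂μ
      = ∫⁻ x in Q, Q.indicator u ((1 - t) • x + t • y) ∂μ := by
        refine setLIntegral_congr_fun hQ fun x hx => ?_
        simp only [e]
        rw [indicator_of_mem]
        exact hconv hx hy h1t.le ht.1 (by ring)
    _ ≤ ∫⁻ x, Q.indicator u ((1 - t) • x + t • y) ∂μ := setLIntegral_le_lintegral _ _
    _ = ENNReal.ofReal (((1 - t) ^ Module.finrank ℝ X)⁻¹) * ∫⁻ x in Q, u x ∂μ := by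
        rw [lintegral_comp_homothety μ h1t _ (hu.indicator hQ), lintegral_indicator hQ]
    _ ≤ _ := by
        gcongr
        rw [← inv_pow, ENNReal.ofReal_pow (by positivity)]
        gcongr
        rw [← ENNReal.ofReal_ofNat]
        refine ENNReal.ofReal_le_ofReal ?_
        rw [inv_le_comm₀ h1t (by norm_num)]
        linarith [ht.2]

/-- The `L¹` Poincaré inequality for `C¹` functions on a convex set. -/
lemma lintegral_lintegral_enorm_sub_le {E : Type*} [NormedAddCommGroup E] [NormedSpace ℝ E]
    {Q : Set X} (hQ : MeasurableSet Q) (hQfin : μ Q ≠ ∞) (hconv : Convex ℝ Q) {d : ℝ≥0∞}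
    (hd : ∀ x ∈ Q, ∀ y ∈ Q, ‖y - x‖ₑ ≤ d) {F : X → E} (hF : ContDiff ℝ 1 F) {u : X → ℝ≥0∞}
    (hu : Measurable u) (hFu : ∀ x v, ‖fderiv ℝ F x v‖ₑ ≤ u x * ‖v‖ₑ) :
    ∫⁻ x in Q, ∫⁻ y in Q, ‖F x - F y‖ₑ ∂μ ∂μ ≤
      2 ^ Module.finrank ℝ X * d * μ Q * ∫⁻ x in Q, u x ∂μ := by
  have : IsFiniteMeasure (μ.restrict Q) := ⟨by simpa using hQfin.lt_top⟩
  set m : X → X → X := fun x y => x + (1 / 2 : ℝ) • (y - x) with hm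
  have hsymm : ∀ x y, m x y = m y x := fun x y => by simp only [hm]; module
  have hcont : Continuous F := hF.continuous
  have hseg : ∀ x ∈ Q, ∀ y ∈ Q, ‖F x - F (m x y)‖ₑ ≤
      d * ∫⁻ t in Icc (0 : ℝ) (1 / 2), u (x + t • (y - x)) := by
    intro x hx y hy
    have hγ : ContDiff ℝ 1 fun t : ℝ => F (x + t • (y - x)) := by fun_prop
    have h1 := enorm_sub_le_lintegral_deriv_of_contDiffOn_Icc (a := 0) (b := 1 / 2)
      hγ.contDiffOn (by norm_num)
    rw [enorm_sub_rev]
    simp only [zero_smul, add_zero] at h1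
    refine h1.trans ?_
    rw [← lintegral_const_mul _ (by fun_prop)]
    refine lintegral_mono fun t => ?_
    have hder : HasDerivAt (fun t : ℝ => F (x + t • (y - x)))
        (fderiv ℝ F (x + t • (y - x)) (y - x)) t := by
      have hl : HasDerivAt (fun t : ℝ => x + t • (y - x)) (y - x) t := by
        simpa using ((hasDerivAt_id t).smul_const (y - x)).const_add x
      exact ((hF.differentiable (by norm_num)) _).hasFDerivAt.comp_hasDerivAt t hl
    rw [hder.deriv, mul_comm]
    exact (hFu _ _).trans (mul_le_mul_right (hd x hx y hy) _)
  have hhalf : ∫⁻ x in Q, ∫⁻ y in Q, ‖F x - F (m x y)‖ₑ ∂μ ∂μ ≤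
      (2 : ℝ≥0∞)⁻¹ * (2 ^ Module.finrank ℝ X * d * μ Q * ∫⁻ x in Q, u x ∂μ) := by
    calc ∫⁻ x in Q, ∫⁻ y in Q, ‖F x - F (m x y)‖ₑ ∂μ ∂μ
        ≤ ∫⁻ x in Q, ∫⁻ y in Q, d * (∫⁻ t in Icc (0 : ℝ) (1 / 2), u (x + t • (y - x))) ∂μ ∂μ :=
          setLIntegral_mono' hQ fun x hx => setLIntegral_mono' hQ fun y hy => hseg x hx y hy
      _ = ∫⁻ y in Q, ∫⁻ x in Q, d * (∫⁻ t in Icc (0 : ℝ) (1 / 2), u (x + t • (y - x))) ∂μ ∂μ := by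
          refine lintegral_lintegral_swap (Measurable.aemeasurable ?_)
          refine Measurable.const_mul (Measurable.lintegral_prod_right'
            (f := fun z : (X × X) × ℝ => u (z.1.1 + z.2 • (z.1.2 - z.1.1))) ?_) _
          fun_prop
      _ = ∫⁻ y in Q, d * (∫⁻ t in Icc (0 : ℝ) (1 / 2), ∫⁻ x in Q, u (x + t • (y - x)) ∂μ) ∂μ := by
          refine lintegral_congr fun y => ?_
          rw [lintegral_const_mul _ (Measurable.lintegral_prod_right'
            (f := fun z : X × ℝ => u (z.1 + z.2 • (y - z.1))) (by fun_prop))]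
          congr 1
          exact lintegral_lintegral_swap (Measurable.aemeasurable (by fun_prop))
      _ ≤ ∫⁻ y in Q, d * (∫⁻ _t in Icc (0 : ℝ) (1 / 2),
            2 ^ Module.finrank ℝ X * ∫⁻ x in Q, u x ∂μ) ∂μ := by
          refine setLIntegral_mono' hQ fun y hy => ?_
          gcongr 1
          exact setLIntegral_mono' measurableSet_Icc fun t ht =>
            setLIntegral_comp_segment_le μ hQ hconv hu ht hy
      _ = _ := by
          simp only [setLIntegral_const, Real.volume_Icc]
          rw [sub_zero, one_div, ENNReal.ofReal_inv_of_pos (by norm_num), ENNReal.ofReal_ofNat]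
          ring
  calc ∫⁻ x in Q, ∫⁻ y in Q, ‖F x - F y‖ₑ ∂μ ∂μ
      ≤ ∫⁻ x in Q, ∫⁻ y in Q, (‖F x - F (m x y)‖ₑ + ‖F y - F (m y x)‖ₑ) ∂μ ∂μ := by
        gcongr with x y
        rw [← edist_eq_enorm_sub, ← edist_eq_enorm_sub, ← edist_eq_enorm_sub, hsymm y x]
        exact edist_triangle_right _ _ _
    _ = ∫⁻ x in Q, ∫⁻ y in Q, ‖F x - F (m x y)‖ₑ ∂μ ∂μ +
          ∫⁻ x in Q, ∫⁻ y in Q, ‖F y - F (m y x)‖ₑ ∂μ ∂μ := by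
        rw [← lintegral_add_left]
        · refine lintegral_congr fun x => lintegral_add_left ?_ _
          exact (by fun_prop : Continuous fun y => ‖F x - F (m x y)‖ₑ).measurable
        · exact Measurable.lintegral_prod_right' (f := fun z : X × X => ‖F z.1 - F (m z.1 z.2)‖ₑ)
            (by fun_prop : Continuous _).measurable
    _ = ∫⁻ x in Q, ∫⁻ y in Q, ‖F x - F (m x y)‖ₑ ∂μ ∂μ +
          ∫⁻ x in Q, ∫⁻ y in Q, ‖F x - F (m x y)‖ₑ ∂μ ∂μ := by
        congr 1
        exact lintegral_lintegral_swap ((by fun_prop : Continuous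
          fun z : X × X => ‖F z.2 - F (m z.2 z.1)‖ₑ).aemeasurable)
    _ ≤ _ := by
        refine (add_le_add hhalf hhalf).trans_eq ?_
        rw [← add_mul, ENNReal.inv_two_add_inv_two, one_mul]

end Poincare

section Mollification

lemma locallyIntegrable_indicator_of_continuousOn {X E : Type*} [TopologicalSpace X] [T2Space X]
    [MeasurableSpace X] [BorelSpace X] (μ : Measure X) [IsFiniteMeasureOnCompacts μ]
    [NormedAddCommGroup E] {K : Set X} {f : X → E} (hK : IsCompact K) (hf : ContinuousOn f K) :
    LocallyIntegrable (K.indicator f) μ :=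
  ((hf.integrableOn_compact' hK hK.measurableSet).integrable_indicator
    hK.measurableSet).locallyIntegrable

variable {X : Type*} [NormedAddCommGroup X] [InnerProductSpace ℝ X] [FiniteDimensional ℝ X]
  [MeasurableSpace X] [BorelSpace X] (μ : Measure X) [μ.IsAddHaarMeasure]
  {E : Type*} [NormedAddCommGroup E] [NormedSpace ℝ E]

/-- `D` satisfies the integration by parts identity of a weak derivative of `f` on `U`. -/
def IntegralByPartsOn (U : Set X) (f : X → E) (D : X → X →L[ℝ] E) : Prop :=
  ∀ ψ : X → ℝ, ContDiff ℝ (⊤ : ℕ∞) ψ → HasCompactSupport ψ → tsupport ψ ⊆ U →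
    ∀ v : X, ∫ x in U, ψ x • D x v ∂μ = - ∫ x in U, (fderiv ℝ ψ x v) • f x ∂μ

/-- The mollification of `f`, cut off outside `K`, with the bump function `b`. -/
def mollify (b : ContDiffBump (0 : X)) (K : Set X) (f : X → E) : X → E :=
  convolution (b.normed μ) (K.indicator f) (ContinuousLinearMap.lsmul ℝ ℝ) μ

variable {U K : Set X} {f : X → E} {D : X → X →L[ℝ] E}

lemma contDiff_mollify (b : ContDiffBump (0 : X)) (hK : IsCompact K) (hf : ContinuousOn f K) :
    ContDiff ℝ 1 (mollify μ b K f) :=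
  mod_cast b.hasCompactSupport_normed.contDiff_convolution_left (n := 1)
    (ContinuousLinearMap.lsmul ℝ ℝ) b.contDiff_normed
    (locallyIntegrable_indicator_of_continuousOn μ hK hf)

lemma enorm_fderiv_mollify_le (b : ContDiffBump (0 : X)) (hK : IsCompact K)
    (hf : ContinuousOn f K) (hU : MeasurableSet U) (hKU : K ⊆ U)
    (hD : IntegralByPartsOn μ U f D) {z : X} {T : Set X} (hT : MeasurableSet T)
    (hzT : closedBall z b.rOut ⊆ T) (hTK : T ⊆ K) :
    ‖fderiv ℝ (mollify μ b K f) z‖ₑ ≤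
      ∫⁻ x in T, ENNReal.ofReal (b.normed μ (z - x)) * ‖D x‖ₑ ∂μ := by
  have hρ : ContDiff ℝ (⊤ : ℕ∞) (b.normed μ) := b.contDiff_normed
  have hd := b.hasCompactSupport_normed.hasFDerivAt_convolution_left (μ := μ)
    (ContinuousLinearMap.lsmul ℝ ℝ) (hρ.of_le (mod_cast le_top))
    (locallyIntegrable_indicator_of_continuousOn μ hK hf) z
  have hzero : ∀ x ∉ T, b.normed μ (z - x) = 0 := fun x hx => by
    by_contra h
    have h2 : z - x ∈ Function.support (b.normed μ) := h
    rw [b.support_normed_eq, mem_ball_zero_iff] at h2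
    exact hx (hzT (mem_closedBall'.2 (by rw [dist_eq_norm]; exact h2.le)))
  set ψ : X → ℝ := fun x => b.normed μ (z - x) with hψ
  have hψs : Function.support ψ ⊆ closedBall z b.rOut := fun x hx => by
    have h2 : z - x ∈ Function.support (b.normed μ) := hx
    rw [b.support_normed_eq, mem_ball_zero_iff] at h2
    exact mem_closedBall'.2 (by rw [dist_eq_norm]; exact h2.le)
  have hψt : tsupport ψ ⊆ closedBall z b.rOut := closure_minimal hψs isClosed_closedBall
  have hψf : ∀ x v, fderiv ℝ ψ x v = - fderiv ℝ (b.normed μ) (z - x) v := fun x v => by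
    have h1 : HasFDerivAt ψ ((fderiv ℝ (b.normed μ) (z - x)).comp
        (-ContinuousLinearMap.id ℝ X)) x :=
      ((hρ.differentiable (by simp)) _).hasFDerivAt.comp x ((hasFDerivAt_id x).const_sub z)
    rw [h1.fderiv]
    simp
  have hIBP := hD ψ (hρ.comp (contDiff_const.sub contDiff_id))
    (HasCompactSupport.of_support_subset_isCompact (isCompact_closedBall _ _) hψs)
    (hψt.trans ((hzT.trans hTK).trans hKU))
  refine ContinuousLinearMap.opENorm_le_bound _ fun v => ?_
  have key : fderiv ℝ (mollify μ b K f) z v = ∫ x in U, ψ x • D x v ∂μ := by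
    rw [mollify, hd.fderiv, hIBP v, convolution_def, ContinuousLinearMap.integral_apply]
    · simp only [ContinuousLinearMap.precompL_apply, ContinuousLinearMap.lsmul_apply]
      rw [← integral_sub_left_eq_self _ μ z, ← integral_neg, ← integral_indicator hU]
      refine integral_congr_ae (.of_forall fun x => ?_)
      have hzx : z - (z - x) = x := sub_sub_cancel z x
      beta_reduce
      rw [hzx]
      by_cases hx : x ∈ K
      · rw [indicator_of_mem hx, indicator_of_mem (hKU hx), hψf, neg_smul, neg_neg]
      · rw [indicator_of_notMem hx, smul_zero]
        by_cases hxU : x ∈ U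
        · have : fderiv ℝ ψ x = 0 := by
            by_contra h
            exact hx (hTK (hzT (hψt (support_fderiv_subset ℝ h))))
          rw [indicator_of_mem hxU, this]
          simp
        · rw [indicator_of_notMem hxU]
    · exact (b.hasCompactSupport_normed.fderiv ℝ).convolutionExists_left _
        (hρ.continuous_fderiv (by simp)) (locallyIntegrable_indicator_of_continuousOn μ hK hf) z
  rw [key]
  calc ‖∫ x in U, ψ x • D x v ∂μ‖ₑ ≤ ∫⁻ x in U, ‖ψ x • D x v‖ₑ ∂μ :=
        enorm_integral_le_lintegral_enorm _
    _ ≤ ∫⁻ x in T, ‖ψ x • D x v‖ₑ ∂μ := by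
        rw [← lintegral_indicator hU, ← lintegral_indicator hT]
        refine lintegral_mono fun x => ?_
        by_cases hx : x ∈ T
        · rw [indicator_of_mem hx]
          exact indicator_le_self _ _ _
        · rw [indicator_of_notMem hx]
          refine (indicator_le_self _ _ _).trans ?_
          simp [hψ, hzero x hx]
    _ ≤ ∫⁻ x in T, ENNReal.ofReal (b.normed μ (z - x)) * ‖D x‖ₑ * ‖v‖ₑ ∂μ := by
        refine lintegral_mono fun x => ?_
        rw [enorm_smul, Real.enorm_of_nonneg (b.nonneg_normed _), mul_assoc]
        gcongr
        exact (D x).le_opENorm v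
    _ = _ := lintegral_mul_const' _ _ enorm_ne_top

lemma lintegral_ofReal_normed_sub (b : ContDiffBump (0 : X)) (x : X) :
    ∫⁻ z, ENNReal.ofReal (b.normed μ (z - x)) ∂μ = 1 := by
  rw [lintegral_sub_right_eq_self (fun z => ENNReal.ofReal (b.normed μ z)) x,
    ← ofReal_integral_eq_lintegral_ofReal b.integrable_normed
      (.of_forall fun x => b.nonneg_normed x), b.integral_normed, ENNReal.ofReal_one]

lemma setLIntegral_enorm_fderiv_mollify_le (b : ContDiffBump (0 : X)) (hK : IsCompact K)
    (hf : ContinuousOn f K) (hU : MeasurableSet U) (hKU : K ⊆ U)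
    (hD : IntegralByPartsOn μ U f D) (hDm : Measurable fun x => ‖D x‖ₑ) {A : Set X}
    (hA : IsCompact A) (hAK : cthickening b.rOut A ⊆ K) :
    ∫⁻ z in A, ‖fderiv ℝ (mollify μ b K f) z‖ₑ ∂μ ≤
      ∫⁻ x in cthickening b.rOut A, ‖D x‖ₑ ∂μ := by
  have hTm : MeasurableSet (cthickening b.rOut A) := isClosed_cthickening.measurableSet
  have hρc : Continuous (b.normed μ) := (b.contDiff_normed (n := 0)).continuous
  have hmeas : Measurable fun p : X × X => ENNReal.ofReal (b.normed μ (p.1 - p.2)) * ‖D p.2‖ₑ :=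
    (hρc.comp (continuous_fst.sub continuous_snd)).measurable.ennreal_ofReal.mul
      (hDm.comp measurable_snd)
  calc ∫⁻ z in A, ‖fderiv ℝ (mollify μ b K f) z‖ₑ ∂μ
      ≤ ∫⁻ z in A, ∫⁻ x in cthickening b.rOut A,
          ENNReal.ofReal (b.normed μ (z - x)) * ‖D x‖ₑ ∂μ ∂μ :=
        setLIntegral_mono' hA.measurableSet fun z hz => enorm_fderiv_mollify_le μ b hK hf hU hKU hD
          hTm (closedBall_subset_cthickening hz _) hAK
    _ = ∫⁻ x in cthickening b.rOut A, ∫⁻ z in A,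
          ENNReal.ofReal (b.normed μ (z - x)) * ‖D x‖ₑ ∂μ ∂μ :=
        lintegral_lintegral_swap hmeas.aemeasurable
    _ ≤ ∫⁻ x in cthickening b.rOut A, ‖D x‖ₑ ∂μ := by
        refine lintegral_mono fun x => ?_
        rw [lintegral_mul_const _ (by fun_prop)]
        refine (mul_le_mul_left (setLIntegral_le_lintegral _ _) _).trans ?_
        rw [lintegral_ofReal_normed_sub, one_mul]

/-- A continuous function with locally integrable weak derivative can be approximated pointwise on
a compact set by `C¹` functions without increasing the `L¹` norm of the derivative. -/
lemma exists_contDiff_tendsto [CompleteSpace E] (hU : IsOpen U) (hf : ContinuousOn f U)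
    (hD : IntegralByPartsOn μ U f D) (hDm : Measurable fun x => ‖D x‖ₑ)
    (hDi : ∀ K ⊆ U, IsCompact K → ∫⁻ x in K, ‖D x‖ₑ ∂μ ≠ ∞) {A : Set X}
    (hA : IsCompact A) (hAU : A ⊆ U) :
    ∃ F : ℕ → X → E, (∀ i, ContDiff ℝ 1 (F i)) ∧
      (∀ z ∈ A, Filter.Tendsto (fun i => F i z) Filter.atTop (𝓝 (f z))) ∧
      Filter.liminf (fun i => ∫⁻ z in A, ‖fderiv ℝ (F i) z‖ₑ ∂μ) Filter.atTop ≤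
        ∫⁻ z in A, ‖D z‖ₑ ∂μ := by
  obtain ⟨δ, hδ, hδU⟩ := hA.exists_cthickening_subset_open hU hAU
  set K := cthickening δ A with hKdef
  have hK : IsCompact K := hA.cthickening
  have hfK : ContinuousOn f K := hf.mono hδU
  let b : ℕ → ContDiffBump (0 : X) := fun i =>
    ⟨δ / (i + 1) / 2, δ / (i + 1), by positivity, half_lt_self (by positivity)⟩
  have hbδ : ∀ i, (b i).rOut ≤ δ := fun i => div_le_self hδ.le (by simp)
  have hb0 : Filter.Tendsto (fun i => (b i).rOut) Filter.atTop (𝓝 0) := by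
    simpa [b, div_eq_mul_inv] using
      (tendsto_one_div_add_atTop_nhds_zero_nat (𝕜 := ℝ)).const_mul δ
  have hbK : ∀ i, cthickening (b i).rOut A ⊆ K := fun i => cthickening_mono (hbδ i) _
  refine ⟨fun i => mollify μ (b i) K f, fun i => contDiff_mollify μ (b i) hK hfK, fun z hz => ?_, ?_⟩
  · have hzK : K ∈ 𝓝 z := Filter.mem_of_superset (ball_mem_nhds z hδ)
      (ball_subset_closedBall.trans (closedBall_subset_cthickening hz _))
    refine ContDiffBump.convolution_tendsto_right (k := fun _ => z) (g := fun _ => K.indicator f)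
      hb0 (.of_forall fun _ => (locallyIntegrable_indicator_of_continuousOn μ hK
        hfK).aestronglyMeasurable) ?_ tendsto_const_nhds
    have h1 : Filter.Tendsto (K.indicator f) (𝓝 z) (𝓝 (f z)) :=
      ((hf z (hAU hz)).continuousAt (hU.mem_nhds (hAU hz))).congr'
        (by filter_upwards [hzK] with y hy; rw [indicator_of_mem hy])
    exact h1.comp Filter.tendsto_snd
  · set ν := (μ.restrict K).withDensity fun x => ‖D x‖ₑ
    have : IsFiniteMeasure ν := ⟨by
      rw [withDensity_apply _ .univ, setLIntegral_univ]
      exact (hDi K hδU hK).lt_top⟩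
    have hν : ∀ S ⊆ K, MeasurableSet S → ν S = ∫⁻ x in S, ‖D x‖ₑ ∂μ := fun S hS hSm => by
      rw [withDensity_apply _ hSm, Measure.restrict_restrict hSm, inter_eq_left.2 hS]
    have h1 : Filter.Tendsto (fun i => ν (cthickening (b i).rOut A)) Filter.atTop (𝓝 (ν A)) :=
      (tendsto_measure_cthickening_of_isCompact hA).comp hb0
    rw [hν A (self_subset_cthickening _) hA.measurableSet] at h1
    rw [← h1.liminf_eq]
    refine Filter.liminf_le_liminf (.of_forall fun i => ?_)
    rw [hν _ (hbK i) isClosed_cthickening.measurableSet]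
    exact setLIntegral_enorm_fderiv_mollify_le μ (b i) hK hfK hU.measurableSet hδU hD hDm hA (hbK i)

end Mollification

section Slices

variable {k : ℕ}

/-- The point of the hyperplane `{x | x j = c}` whose remaining coordinates are given by `y`. -/
def sliceMap (j : Fin (k + 1)) (c : ℝ) (y : Fin k → ℝ) : Euc (k + 1) :=
  WithLp.toLp 2 (j.insertNth c y)

@[simp]
lemma sliceMap_apply_same (j : Fin (k + 1)) (c : ℝ) (y : Fin k → ℝ) : sliceMap j c y j = c := by
  simp [sliceMap]

@[simp]
lemma sliceMap_apply_succAbove (j : Fin (k + 1)) (c : ℝ) (y : Fin k → ℝ) (i : Fin k) :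
    sliceMap j c y (j.succAbove i) = y i := by
  simp [sliceMap]

lemma sliceMap_removeNth (j : Fin (k + 1)) (x : Euc (k + 1)) :
    sliceMap j (x j) (fun i => x (j.succAbove i)) = x := by
  ext i
  rcases j.eq_self_or_eq_succAbove i with rfl | ⟨i, rfl⟩ <;> simp

lemma continuous_sliceMap (j : Fin (k + 1)) :
    Continuous fun p : ℝ × (Fin k → ℝ) => sliceMap j p.1 p.2 :=
  (PiLp.continuous_toLp 2 _).comp (Continuous.finInsertNth (A := fun _ => ℝ) j continuous_fst continuous_snd)

lemma continuous_sliceMap_right (j : Fin (k + 1)) (c : ℝ) : Continuous (sliceMap j c) :=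
  (continuous_sliceMap j).comp (continuous_const.prodMk continuous_id)

lemma injective_sliceMap (j : Fin (k + 1)) :
    Function.Injective fun p : ℝ × (Fin k → ℝ) => sliceMap j p.1 p.2 := by
  rintro ⟨c, y⟩ ⟨c', y'⟩ h
  refine Prod.ext ?_ (funext fun i => ?_)
  · simpa using congrArg (fun v => v j) h
  · simpa using congrArg (fun v => v (j.succAbove i)) h

lemma measurePreserving_sliceMap (j : Fin (k + 1)) :
    MeasurePreserving (fun p : ℝ × (Fin k → ℝ) => sliceMap j p.1 p.2) volume volume :=
  (PiLp.volume_preserving_toLp (Fin (k + 1))).comp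
    (volume_preserving_piFinSuccAbove (fun _ => ℝ) j).symm

lemma antilipschitzWith_sliceMap (j : Fin (k + 1)) (c : ℝ) :
    AntilipschitzWith 1 (sliceMap j c) := by
  refine AntilipschitzWith.of_le_mul_dist fun y y' => ?_
  rw [NNReal.coe_one, one_mul, dist_pi_le_iff dist_nonneg]
  intro i
  have := PiLp.norm_apply_le (sliceMap j c y - sliceMap j c y') (j.succAbove i)
  simpa [dist_eq_norm] using this

/-- The linear part of `sliceMap`. -/
def sliceDirection (j : Fin (k + 1)) : (Fin k → ℝ) →L[ℝ] Euc (k + 1) :=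
  LinearMap.toContinuousLinearMap
    { toFun := sliceMap j 0
      map_add' := fun y y' => by
        ext i; rcases j.eq_self_or_eq_succAbove i with rfl | ⟨i, rfl⟩ <;> simp
      map_smul' := fun a y => by
        ext i; rcases j.eq_self_or_eq_succAbove i with rfl | ⟨i, rfl⟩ <;> simp }

lemma sliceMap_eq_add (j : Fin (k + 1)) (c : ℝ) (y : Fin k → ℝ) :
    sliceMap j c y = sliceMap j c 0 + sliceDirection j y := by
  change _ = _ + sliceMap j 0 y
  ext i
  rcases j.eq_self_or_eq_succAbove i with rfl | ⟨i, rfl⟩ <;> simp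

lemma hasFDerivAt_sliceMap (j : Fin (k + 1)) (c : ℝ) (y : Fin k → ℝ) :
    HasFDerivAt (sliceMap j c) (sliceDirection j) y := by
  rw [show sliceMap j c = fun y => sliceMap j c 0 + sliceDirection j y from
    funext (sliceMap_eq_add j c)]
  exact (sliceDirection j).hasFDerivAt.const_add _

lemma contDiff_sliceMap (j : Fin (k + 1)) (c : ℝ) : ContDiff ℝ 1 (sliceMap j c) := by
  rw [show sliceMap j c = fun y => sliceMap j c 0 + sliceDirection j y from
    funext (sliceMap_eq_add j c)]
  fun_prop

lemma setLIntegral_sliceMap (j : Fin (k + 1)) {O : Set ℝ} {Q : Set (Fin k → ℝ)}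
    (hO : IsCompact O) (hQ : IsCompact Q) {G : Euc (k + 1) → ℝ≥0∞} (hG : Measurable G) :
    ∫⁻ c in O, ∫⁻ y in Q, G (sliceMap j c y) =
      ∫⁻ x in (fun p : ℝ × (Fin k → ℝ) => sliceMap j p.1 p.2) '' (O ×ˢ Q), G x := by
  rw [← (measurePreserving_sliceMap j).setLIntegral_comp_preimage
    ((hO.prod hQ).image (continuous_sliceMap j)).measurableSet hG,
    preimage_image_eq _ (injective_sliceMap j), Measure.volume_eq_prod, setLIntegral_prod]
  exact (hG.comp (continuous_sliceMap j).measurable).aemeasurable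

lemma lintegral_lintegral_lintegral_liminf_le {α β γ : Type*} [MeasurableSpace α]
    [MeasurableSpace β] [MeasurableSpace γ] (μ : Measure α) (ν : Measure β) (τ : Measure γ)
    [SFinite ν] [SFinite τ] {G : ℕ → (α × β) × γ → ℝ≥0∞} (hG : ∀ i, Measurable (G i)) :
    ∫⁻ a, ∫⁻ b, ∫⁻ c, Filter.liminf (fun i => G i ((a, b), c)) Filter.atTop ∂τ ∂ν ∂μ ≤
      Filter.liminf (fun i => ∫⁻ a, ∫⁻ b, ∫⁻ c, G i ((a, b), c) ∂τ ∂ν ∂μ) Filter.atTop := by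
  have hG1 : ∀ i, Measurable fun p : α × β => ∫⁻ c, G i (p, c) ∂τ := fun i =>
    (hG i).lintegral_prod_right'
  calc ∫⁻ a, ∫⁻ b, ∫⁻ c, Filter.liminf (fun i => G i ((a, b), c)) Filter.atTop ∂τ ∂ν ∂μ
      ≤ ∫⁻ a, ∫⁻ b, Filter.liminf (fun i => ∫⁻ c, G i ((a, b), c) ∂τ) Filter.atTop ∂ν ∂μ :=
        lintegral_mono fun a => lintegral_mono fun b =>
          lintegral_liminf_le fun i => (hG i).comp measurable_prodMk_left
    _ ≤ ∫⁻ a, Filter.liminf (fun i => ∫⁻ b, ∫⁻ c, G i ((a, b), c) ∂τ ∂ν) Filter.atTop ∂μ :=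
        lintegral_mono fun a => lintegral_liminf_le fun i => (hG1 i).comp measurable_prodMk_left
    _ ≤ _ := lintegral_liminf_le fun i => (hG1 i).lintegral_prod_right'

/-- The Poincaré inequality for a continuous Sobolev function, integrated over parallel slices. -/
lemma lintegral_slices_enorm_sub_le {E : Type*} [NormedAddCommGroup E] [NormedSpace ℝ E]
    [CompleteSpace E] {U : Set (Euc (k + 1))} {f : Euc (k + 1) → E}
    {D : Euc (k + 1) → Euc (k + 1) →L[ℝ] E} (hU : IsOpen U) (hf : ContinuousOn f U)
    (hD : IntegralByPartsOn volume U f D) (hDm : Measurable fun x => ‖D x‖ₑ)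
    (hDi : ∀ K ⊆ U, IsCompact K → ∫⁻ x in K, ‖D x‖ₑ ≠ ∞) (j : Fin (k + 1)) {O : Set ℝ}
    {Q : Set (Fin k → ℝ)} (hO : IsCompact O) (hQ : IsCompact Q) (hconv : Convex ℝ Q) {d : ℝ≥0∞}
    (hd : ∀ x ∈ Q, ∀ y ∈ Q, ‖y - x‖ₑ ≤ d) (hd_top : d ≠ ∞)
    (hOQ : ∀ c ∈ O, ∀ y ∈ Q, sliceMap j c y ∈ U) :
    ∫⁻ c in O, ∫⁻ x in Q, ∫⁻ y in Q, ‖f (sliceMap j c x) - f (sliceMap j c y)‖ₑ ≤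
      2 ^ k * d * volume Q * ‖sliceDirection j‖ₑ *
        ∫⁻ c in O, ∫⁻ y in Q, ‖D (sliceMap j c y)‖ₑ := by
  set A := (fun p : ℝ × (Fin k → ℝ) => sliceMap j p.1 p.2) '' (O ×ˢ Q)
  have hA : IsCompact A := (hO.prod hQ).image (continuous_sliceMap j)
  have hAU : A ⊆ U := by
    rintro _ ⟨p, hp, rfl⟩
    exact hOQ _ hp.1 _ hp.2
  obtain ⟨F, hF, hFf, hFD⟩ := exists_contDiff_tendsto volume hU hf hD hDm hDi hA hAU
  have hFc : ∀ i, Continuous (F i) := fun i => (hF i).continuous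
  have hι : Continuous fun p : ℝ × (Fin k → ℝ) => sliceMap j p.1 p.2 := continuous_sliceMap j
  set M : ℝ≥0∞ := 2 ^ k * d * volume Q * ‖sliceDirection j‖ₑ with hM
  have hM_top : M ≠ ∞ := mul_ne_top (mul_ne_top (mul_ne_top (by simp) hd_top)
    hQ.measure_lt_top.ne) enorm_ne_top
  have hFD' : ∀ i, Measurable fun x => ‖fderiv ℝ (F i) x‖ₑ := fun i =>
    ((hF i).continuous_fderiv (by simp)).enorm.measurable
  have hG : ∀ i, Continuous fun q : (ℝ × (Fin k → ℝ)) × (Fin k → ℝ) =>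
      ‖F i (sliceMap j q.1.1 q.1.2) - F i (sliceMap j q.1.1 q.2)‖ₑ := fun i =>
    (((hFc i).comp (hι.comp continuous_fst)).sub ((hFc i).comp
      (hι.comp ((continuous_fst.comp continuous_fst).prodMk continuous_snd)))).enorm
  have hslice : ∀ i c, ∫⁻ x in Q, ∫⁻ y in Q, ‖F i (sliceMap j c x) - F i (sliceMap j c y)‖ₑ ≤
      M * ∫⁻ y in Q, ‖fderiv ℝ (F i) (sliceMap j c y)‖ₑ := by
    intro i c
    have hu : Measurable fun y => ‖fderiv ℝ (F i) (sliceMap j c y)‖ₑ :=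
      (hFD' i).comp (continuous_sliceMap_right j c).measurable
    have h := lintegral_lintegral_enorm_sub_le volume hQ.measurableSet hQ.measure_lt_top.ne hconv hd
      ((hF i).comp (contDiff_sliceMap j c)) (hu.mul_const ‖sliceDirection j‖ₑ) fun x v => by
        have h1 := (((hF i).differentiable (by simp)) _).hasFDerivAt.comp x
          (hasFDerivAt_sliceMap j c x)
        rw [h1.fderiv, mul_assoc]
        exact ((fderiv ℝ (F i) _).le_opENorm _).trans
          (mul_le_mul_right ((sliceDirection j).le_opENorm v) _)
    refine h.trans_eq ?_
    rw [lintegral_mul_const _ hu, Module.finrank_fin_fun, hM]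
    ring
  calc ∫⁻ c in O, ∫⁻ x in Q, ∫⁻ y in Q, ‖f (sliceMap j c x) - f (sliceMap j c y)‖ₑ
      ≤ ∫⁻ c in O, ∫⁻ x in Q, ∫⁻ y in Q, Filter.liminf
          (fun i => ‖F i (sliceMap j c x) - F i (sliceMap j c y)‖ₑ) Filter.atTop := by
        refine setLIntegral_mono' hO.measurableSet fun c hc => setLIntegral_mono' hQ.measurableSet
          fun x hx => setLIntegral_mono' hQ.measurableSet fun y hy => ?_
        exact (((hFf _ ⟨(c, x), ⟨hc, hx⟩, rfl⟩).sub (hFf _ ⟨(c, y), ⟨hc, hy⟩, rfl⟩)).enorm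
          ).liminf_eq.ge
    _ ≤ Filter.liminf (fun i => ∫⁻ c in O, ∫⁻ x in Q, ∫⁻ y in Q,
          ‖F i (sliceMap j c x) - F i (sliceMap j c y)‖ₑ) Filter.atTop :=
        lintegral_lintegral_lintegral_liminf_le _ _ _ (G := fun i q =>
          ‖F i (sliceMap j q.1.1 q.1.2) - F i (sliceMap j q.1.1 q.2)‖ₑ) fun i => (hG i).measurable
    _ ≤ Filter.liminf (fun i => M * ∫⁻ z in A, ‖fderiv ℝ (F i) z‖ₑ) Filter.atTop := by
        refine Filter.liminf_le_liminf (.of_forall fun i => ?_)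
        rw [← setLIntegral_sliceMap j hO hQ (hFD' i), ← lintegral_const_mul' _ _ hM_top]
        exact lintegral_mono fun c => hslice i c
    _ ≤ _ := by
        rw [ENNReal.liminf_const_mul_of_ne_top hM_top, setLIntegral_sliceMap j hO hQ hDm]
        gcongr

end Slices

section AlmostEverySlice

variable {k m : ℕ}

/-- On almost every slice the Poincaré inequality holds on a given compact convex set. -/
lemma ae_slice_enorm_sub_le {U : Set (Euc (k + 1))} {f : Euc (k + 1) → Euc m}
    {D : Euc (k + 1) → Euc (k + 1) →L[ℝ] Euc m} (hU : IsOpen U) (hf : ContinuousOn f U)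
    (hD : IntegralByPartsOn volume U f D) (hDm : Measurable fun x => ‖D x‖ₑ)
    (hDi : ∀ K ⊆ U, IsCompact K → ∫⁻ x in K, ‖D x‖ₑ ≠ ∞) (j : Fin (k + 1))
    {Q : Set (Fin k → ℝ)} (hQ : IsCompact Q) (hconv : Convex ℝ Q) {d : ℝ≥0∞}
    (hd : ∀ x ∈ Q, ∀ y ∈ Q, ‖y - x‖ₑ ≤ d) (hd_top : d ≠ ∞) :
    ∀ᵐ c : ℝ, (∀ y ∈ Q, sliceMap j c y ∈ U) →
      ∫⁻ x in Q, ∫⁻ y in Q, ‖f (sliceMap j c x) - f (sliceMap j c y)‖ₑ ≤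
        2 ^ k * d * volume Q * ‖sliceDirection j‖ₑ * ∫⁻ y in Q, ‖D (sliceMap j c y)‖ₑ := by
  classical
  have hι : Continuous fun p : ℝ × (Fin k → ℝ) => sliceMap j p.1 p.2 := continuous_sliceMap j
  set M : ℝ≥0∞ := 2 ^ k * d * volume Q * ‖sliceDirection j‖ₑ with hM
  have hM_top : M ≠ ∞ := mul_ne_top (mul_ne_top (mul_ne_top (by simp) hd_top)
    hQ.measure_lt_top.ne) enorm_ne_top
  set V : Set ℝ := {c | ∀ y ∈ Q, sliceMap j c y ∈ U} with hV
  have hVo : IsOpen V := isOpen_iff_mem_nhds.2 fun c hc =>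
    hQ.eventually_forall_of_forall_eventually (P := fun c y => sliceMap j c y ∈ U) fun y hy =>
      (hU.preimage hι).mem_nhds (hc y hy)
  have hf' : Measurable (U.indicator f) := by
    rw [← piecewise_eq_indicator]
    exact hf.measurable_piecewise continuousOn_const hU.measurableSet
  set a : ℝ → ℝ≥0∞ := fun c => ∫⁻ x in Q, ∫⁻ y in Q,
    ‖U.indicator f (sliceMap j c x) - U.indicator f (sliceMap j c y)‖ₑ with ha
  set b : ℝ → ℝ≥0∞ := fun c => M * ∫⁻ y in Q, ‖D (sliceMap j c y)‖ₑ with hb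
  have haV : ∀ c ∈ V, a c =
      ∫⁻ x in Q, ∫⁻ y in Q, ‖f (sliceMap j c x) - f (sliceMap j c y)‖ₑ := by
    intro c hc
    refine setLIntegral_congr_fun hQ.measurableSet fun x hx =>
      setLIntegral_congr_fun hQ.measurableSet fun y hy => ?_
    rw [indicator_of_mem (hc x hx), indicator_of_mem (hc y hy)]
  have ham : Measurable a := by
    have h1 : Measurable fun q : (ℝ × (Fin k → ℝ)) × (Fin k → ℝ) =>
        ‖U.indicator f (sliceMap j q.1.1 q.1.2) - U.indicator f (sliceMap j q.1.1 q.2)‖ₑ :=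
      ((hf'.comp (hι.comp continuous_fst).measurable).sub (hf'.comp
        (hι.comp ((continuous_fst.comp continuous_fst).prodMk continuous_snd)).measurable)).enorm
    exact h1.lintegral_prod_right'.lintegral_prod_right'
  have hbm : Measurable b := (hDm.comp hι.measurable).lintegral_prod_right'.const_mul M
  have hBm : MeasurableSet (V ∩ {c | b c < a c}) :=
    hVo.measurableSet.inter (measurableSet_lt hbm ham)
  have hB0 : volume (V ∩ {c | b c < a c}) = 0 := by
    by_contra hne
    obtain ⟨O, hOB, hO, hpos⟩ := hBm.exists_lt_isCompact (pos_iff_ne_zero.2 hne)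
    have hA : IsCompact ((fun p : ℝ × (Fin k → ℝ) => sliceMap j p.1 p.2) '' (O ×ˢ Q)) :=
      (hO.prod hQ).image hι
    have hAU : (fun p : ℝ × (Fin k → ℝ) => sliceMap j p.1 p.2) '' (O ×ˢ Q) ⊆ U := by
      rintro _ ⟨p, hp, rfl⟩
      exact (hOB hp.1).1 _ hp.2
    have hbO : ∫⁻ c in O, b c = M * ∫⁻ c in O, ∫⁻ y in Q, ‖D (sliceMap j c y)‖ₑ :=
      lintegral_const_mul' _ _ hM_top
    have hfin : ∫⁻ c in O, b c ≠ ∞ := by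
      rw [hbO, setLIntegral_sliceMap j hO hQ hDm]
      exact mul_ne_top hM_top (hDi _ hAU hA)
    have hlt := setLIntegral_strict_mono hO.measurableSet hpos.ne' ham hfin
      (.of_forall fun c hc => (hOB hc).2)
    refine hlt.not_ge ?_
    rw [hbO, setLIntegral_congr_fun hO.measurableSet fun c hc => haV c (hOB hc).1]
    exact lintegral_slices_enorm_sub_le hU hf hD hDm hDi j hO hQ hconv hd hd_top
      fun c hc y hy => (hOB hc).1 y hy
  filter_upwards [measure_eq_zero_iff_ae_notMem.1 hB0] with c hc hcV
  rw [← haV c hcV]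
  exact not_lt.1 fun h => hc ⟨hcV, h⟩

lemma convex_dyadicCube (N : ℕ) (a : Fin k → ℤ) : Convex ℝ (dyadicCube N a) := convex_Icc _ _

lemma enorm_sub_le_of_mem_dyadicCube {N : ℕ} {a : Fin k → ℤ} {x y : Fin k → ℝ}
    (hx : x ∈ dyadicCube N a) (hy : y ∈ dyadicCube N a) : ‖y - x‖ₑ ≤ ((2 : ℝ≥0∞) ^ N)⁻¹ := by
  have h := mem_closedBall.1 (dyadicCube_subset_closedBall hx hy)
  rw [← edist_eq_enorm_sub, edist_dist]
  refine (ENNReal.ofReal_le_ofReal h).trans_eq ?_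
  rw [one_div, inv_pow, ENNReal.ofReal_inv_of_pos (by positivity),
    ENNReal.ofReal_pow zero_le_two, ENNReal.ofReal_ofNat]

lemma norm_le_frobNorm {n : ℕ} (A : Euc n →L[ℝ] Euc m) : ‖A‖ ≤ frobNorm A := by
  refine A.opNorm_le_bound (Real.sqrt_nonneg _) fun v => ?_
  have hv : v = ∑ l, v l • EuclideanSpace.single l (1 : ℝ) := by
    ext i
    simp [Finset.sum_apply, Pi.single_apply]
  rw [EuclideanSpace.norm_eq, EuclideanSpace.norm_eq v, frobNorm,
    ← Real.sqrt_mul (Finset.sum_nonneg fun _ _ => Finset.sum_nonneg fun _ _ => sq_nonneg _)]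
  refine Real.sqrt_le_sqrt ?_
  simp only [Real.norm_eq_abs, sq_abs]
  rw [Finset.sum_mul]
  refine Finset.sum_le_sum fun i _ => ?_
  have h1 : A v i = ∑ l, A (EuclideanSpace.single l 1) i * v l := by
    conv_lhs => rw [hv]
    simp [mul_comm]
  rw [h1]
  exact Finset.sum_mul_sq_le_sq_mul_sq _ _ _

lemma frobNorm_nonneg {n : ℕ} (A : Euc n →L[ℝ] Euc m) : 0 ≤ frobNorm A := Real.sqrt_nonneg _

lemma continuous_frobNorm {n : ℕ} : Continuous (frobNorm : (Euc n →L[ℝ] Euc m) → ℝ) := by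
  unfold frobNorm
  fun_prop

end AlmostEverySlice

section HausdorffSlice

variable {k m : ℕ}

/-- On almost every slice the Hausdorff measure of images is controlled by the integral of
`gradDensity`. -/
lemma ae_exists_hausdorffMeasure_image_slice_le (hk : 2 ≤ k) {φ : ℝ → ℝ}
    (hφ : MonotoneOn φ (Ici 0))
    (hI : ∫⁻ t in Ioi (1 : ℝ),
      (ENNReal.ofReal t / ENNReal.ofReal (φ t)) ^ (1 / ((k : ℝ) - 1)) ≠ ∞)
    {U : Set (Euc (k + 1))} {f : Euc (k + 1) → Euc m}
    {D : Euc (k + 1) → Euc (k + 1) →L[ℝ] Euc m} (hU : IsOpen U) (hf : ContinuousOn f U)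
    (hD : IntegralByPartsOn volume U f D) (hDm : StronglyMeasurable D)
    (hDi : ∀ K ⊆ U, IsCompact K → ∫⁻ x in K, ‖D x‖ₑ ≠ ∞) (j : Fin (k + 1)) :
    ∀ᵐ c : ℝ, ∃ C : ℝ≥0∞, C ≠ ∞ ∧ ∀ W, IsOpen W → W ⊆ sliceMap j c ⁻¹' U →
      ∫⁻ y in W, gradDensity φ (frobNorm (D (sliceMap j c y))) ≠ ∞ → ∀ S ⊆ W,
        μH[(k : ℝ)] ((fun y => f (sliceMap j c y)) '' S) ≤
          C * (volume.restrict W).withDensity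
            (fun y => gradDensity φ (frobNorm (D (sliceMap j c y)))) S := by
  have hP : ∀ᵐ c : ℝ, ∀ (N : ℕ) (a : Fin k → ℤ), (∀ y ∈ dyadicCube N a, sliceMap j c y ∈ U) →
      ∫⁻ x in dyadicCube N a, ∫⁻ y in dyadicCube N a,
        ‖f (sliceMap j c x) - f (sliceMap j c y)‖ₑ ≤
        2 ^ k * ((2 : ℝ≥0∞) ^ N)⁻¹ * volume (dyadicCube N a) * ‖sliceDirection j‖ₑ *
          ∫⁻ y in dyadicCube N a, ‖D (sliceMap j c y)‖ₑ :=
    ae_all_iff.2 fun N => ae_all_iff.2 fun a => ae_slice_enorm_sub_le hU hf hD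
      hDm.enorm hDi j (isCompact_dyadicCube N a) (convex_dyadicCube N a)
      (fun x hx y hy => enorm_sub_le_of_mem_dyadicCube hx hy) (by simp)
  filter_upwards [hP] with c hc
  refine exists_hausdorffMeasure_image_le hk hφ hI (V := sliceMap j c ⁻¹' U)
    (g := fun y => f (sliceMap j c y))
    (H := fun y => frobNorm (D (sliceMap j c y)))
    (hf.comp (continuous_sliceMap_right j c).continuousOn fun _ hy => hy)
    (continuous_frobNorm.comp_stronglyMeasurable (hDm.comp_measurable
      (continuous_sliceMap_right j c).measurable)).measurable
    (C := 2 ^ k * ‖(sliceDirection j : (Fin k → ℝ) →L[ℝ] Euc (k + 1))‖ₑ)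
    (mul_ne_top (by simp) enorm_ne_top) fun N a ha => ?_
  refine (hc N a fun y hy => ha hy).trans ?_
  rw [volume_dyadicCube]
  calc _ ≤ 2 ^ k * ((2 : ℝ≥0∞) ^ N)⁻¹ * ((2 : ℝ≥0∞) ^ (N * k))⁻¹ * ‖sliceDirection j‖ₑ *
          ∫⁻ y in dyadicCube N a, ENNReal.ofReal (frobNorm (D (sliceMap j c y))) := by
        gcongr with y
        rw [← ofReal_norm]
        exact ENNReal.ofReal_le_ofReal (norm_le_frobNorm _)
    _ = _ := by ring

/-- Locally integrable functions are locally integrable on almost every slice. -/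
lemma ae_slice_setLIntegral_ne_top (j : Fin (k + 1)) {K : Set (Euc (k + 1))}
    (hK : MeasurableSet K) {G : Euc (k + 1) → ℝ≥0∞} (hG : Measurable G)
    (hfin : ∫⁻ x in K, G x ≠ ∞) :
    ∀ᵐ c : ℝ, ∫⁻ y in sliceMap j c ⁻¹' K, G (sliceMap j c y) ≠ ∞ := by
  have hι : Continuous fun p : ℝ × (Fin k → ℝ) => sliceMap j p.1 p.2 := continuous_sliceMap j
  have hGK : Measurable (K.indicator G) := hG.indicator hK
  have hcomp : Measurable fun p : ℝ × (Fin k → ℝ) => K.indicator G (sliceMap j p.1 p.2) :=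
    hGK.comp hι.measurable
  rw [← lintegral_indicator hK, ← (measurePreserving_sliceMap j).lintegral_comp hGK,
    Measure.volume_eq_prod, lintegral_prod _ hcomp.aemeasurable] at hfin
  filter_upwards [ae_lt_top hcomp.lintegral_prod_right' hfin] with c hc
  rw [← lintegral_indicator ((continuous_sliceMap_right j c).measurable hK)]
  exact hc.ne

lemma ae_slice_of_ae (j : Fin (k + 1)) {p : Euc (k + 1) → Prop} (hp : ∀ᵐ x, p x) :
    ∀ᵐ c : ℝ, ∀ᵐ y : Fin k → ℝ, p (sliceMap j c y) :=
  Measure.ae_ae_of_ae_prod ((measurePreserving_sliceMap j).quasiMeasurePreserving.ae hp)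

lemma volume_preimage_sliceMap_le (j : Fin (k + 1)) (c : ℝ) (B : Set (Euc (k + 1))) :
    volume (sliceMap j c ⁻¹' B) ≤ μH[(k : ℝ)] B := by
  have h := (antilipschitzWith_sliceMap j c).hausdorffMeasure_preimage_le k.cast_nonneg B
  have hv : (μH[(k : ℝ)] : Measure (Fin k → ℝ)) = volume := by
    simpa using hausdorffMeasure_pi_real (ι := Fin k)
  simpa [hv] using h

lemma sliceMap_preimage_image {j : Fin (k + 1)} {c : ℝ} {B : Set (Euc (k + 1))}
    (hB : B ⊆ {x | x j = c}) : sliceMap j c '' (sliceMap j c ⁻¹' B) = B :=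
  image_preimage_eq_of_subset fun x hx => ⟨_, (hB hx : x j = c) ▸ sliceMap_removeNth j x⟩

lemma measurable_one_add_ofReal_comp {α : Type*} [MeasurableSpace α] {φ : ℝ → ℝ}
    (hφ : MonotoneOn φ (Ici 0)) {H : α → ℝ} (hH : Measurable H) (hH0 : ∀ x, 0 ≤ H x) :
    Measurable fun x => 1 + ENNReal.ofReal (φ (H x)) := by
  have h1 : Monotone fun t => φ (max 0 t) := fun s t hst =>
    hφ (mem_Ici.2 (le_max_left _ _)) (mem_Ici.2 (le_max_left _ _)) (max_le_max_left 0 hst)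
  have h2 : (fun x => φ (H x)) = (fun t => φ (max 0 t)) ∘ H :=
    funext fun x => by simp [max_eq_right (hH0 x)]
  exact measurable_const.add (h2 ▸ h1.measurable.comp hH : Measurable _).ennreal_ofReal

lemma exists_pos_withDensity_lt_of_measure_lt {α : Type*} [MeasurableSpace α] {μ : Measure α}
    {u : α → ℝ≥0∞} (hu : ∫⁻ x, u x ∂μ ≠ ∞) {ε : ℝ≥0∞} (hε : ε ≠ 0) :
    ∃ δ > 0, ∀ s, μ s < δ → μ.withDensity u s < ε := by
  obtain ⟨δ, hδ, h⟩ := exists_pos_setLIntegral_lt_of_measure_lt hu hε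
  refine ⟨δ, hδ, fun s hs => (measure_mono (subset_toMeasurable μ s)).trans_lt ?_⟩
  rw [withDensity_apply _ (measurableSet_toMeasurable _ _)]
  exact h _ (by rwa [measure_toMeasurable])

/-- The conclusions of the theorem on a single slice, given local control of the Hausdorff measure
of images by an integral. -/
lemma lusin_locAbsCont_null_of_hausdorffMeasure_image_le {n m : ℕ} {d : ℝ} {f : Euc n → Euc m}
    {P U : Set (Euc n)} {α : Type*} [MeasurableSpace α] {μ : Measure α}
    {ι : α → Euc n} (hι : ∀ B, μ (ι ⁻¹' B) ≤ μH[d] B) {u : α → ℝ≥0∞} {Z : Set (Euc n)}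
    {C : ℝ≥0∞} (hC : C ≠ ∞) {t : Set (Euc n)} (ht : t.Countable) {b : Euc n → Set (Euc n)}
    (hbo : ∀ x ∈ t, IsOpen (b x)) (hcov : U ⊆ ⋃ x ∈ t, b x)
    (hu : ∀ x ∈ t, ∫⁻ y in ι ⁻¹' b x, u y ∂μ ≠ ∞)
    (hf : ∀ x ∈ t, ∀ B ⊆ P ∩ b x, μH[d] (f '' B) ≤
      C * (μ.restrict (ι ⁻¹' b x)).withDensity u (ι ⁻¹' B))
    (hZ : ∀ x ∈ t, (μ.restrict (ι ⁻¹' b x)).withDensity u (ι ⁻¹' Z) = 0) :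
    LusinNOn f (P ∩ U) d ∧ LocAbsContOn f (P ∩ U) d ∧
      ∀ E ⊆ P ∩ U, E ⊆ Z → μH[d] (f '' E) = 0 := by
  have hnull : ∀ B ⊆ P ∩ U, (∀ x ∈ t, (μ.restrict (ι ⁻¹' b x)).withDensity u (ι ⁻¹' B) = 0) →
      μH[d] (f '' B) = 0 := by
    intro B hB h0
    have hsub : f '' B ⊆ ⋃ x ∈ t, f '' (B ∩ b x) := by
      rintro _ ⟨z, hz, rfl⟩
      obtain ⟨x, hx, hzx⟩ := mem_iUnion₂.1 (hcov (hB hz).2)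
      exact mem_iUnion₂.2 ⟨x, hx, z, ⟨hz, hzx⟩, rfl⟩
    refine measure_mono_null hsub ((measure_biUnion_null_iff ht).2 fun x hx => ?_)
    refine le_antisymm ((hf x hx _ fun z hz => ⟨(hB hz.1).1, hz.2⟩).trans_eq ?_) zero_le
    rw [measure_mono_null (preimage_mono inter_subset_left) (h0 x hx), mul_zero]
  refine ⟨fun B hB hB0 => hnull B hB fun x _ => ?_, fun x hx => ?_, fun E hE hEZ =>
    hnull E hE fun x hx => measure_mono_null (preimage_mono hEZ) (hZ x hx)⟩
  · refine withDensity_absolutelyContinuous _ _ (Measure.absolutelyContinuous_of_le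
      Measure.restrict_le_self (le_antisymm ((hι B).trans_eq hB0) zero_le))
  · obtain ⟨x', hx', hxb⟩ := mem_iUnion₂.1 (hcov hx.2)
    refine ⟨b x', hbo x' hx', hxb, fun ε hε => ?_⟩
    obtain ⟨δ, hδ, h⟩ := exists_pos_withDensity_lt_of_measure_lt (hu x' hx')
      (ε := ENNReal.ofReal ε / (C + 1))
      (ENNReal.div_ne_zero.2 ⟨(ENNReal.ofReal_pos.2 hε).ne', by simpa using hC⟩)
    have hδ1 : min δ 1 ≠ ∞ := ne_top_of_le_ne_top one_ne_top (min_le_right _ _)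
    refine ⟨(min δ 1).toReal, ENNReal.toReal_pos (by simp [hδ.ne']) hδ1, fun B hB hBδ => ?_⟩
    rw [ENNReal.ofReal_toReal hδ1] at hBδ
    calc μH[d] (f '' B) ≤ C * (μ.restrict (ι ⁻¹' b x')).withDensity u (ι ⁻¹' B) :=
          hf x' hx' B fun z hz => ⟨(hB hz).1.1, (hB hz).2⟩
      _ ≤ (C + 1) * (μ.restrict (ι ⁻¹' b x')).withDensity u (ι ⁻¹' B) := by
          gcongr
          exact le_self_add
      _ < ENNReal.ofReal ε := ENNReal.mul_lt_of_lt_div' (h _ ((Measure.restrict_apply_le _ _).trans_lt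
          ((hι B).trans_lt (hBδ.trans_le (min_le_left _ _)))))

end HausdorffSlice

theorem stmt2 {n m : ℕ} (hn : 3 ≤ n) (hm : 1 ≤ m) (U : Set (Euc n)) (hU : IsOpen U)
    (φ : ℝ → ℝ) (hφmono : MonotoneOn φ (Ici 0)) (hφpos : ∀ t ∈ Ici (0:ℝ), 0 ≤ φ t)
    (hCald : CalderonCondition n φ)
    (f : Euc n → Euc m) (hfc : ContinuousOn f U)
    (Df : Euc n → (Euc n →L[ℝ] Euc m)) (hfW : MemOrliczSobolevWith φ U f Df)
    -- `𝒫₀` is the coordinate hyperplane `{x : x j₀ = 0}`; its parallel translates are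
    -- the hyperplanes `𝒫_c = {x : x j₀ = c}`, `c ∈ ℝ`.
    (j₀ : Fin n) :
    ∀ᵐ c : ℝ ∂volume,
      LusinNOn f ({x : Euc n | x j₀ = c} ∩ U) ((n : ℝ) - 1) ∧
      LocAbsContOn f ({x : Euc n | x j₀ = c} ∩ U) ((n : ℝ) - 1) ∧
      ∀ E ⊆ {x : Euc n | x j₀ = c} ∩ U, (∀ x ∈ E, frobNorm (Df x) = 0) →
        μH[(n : ℝ) - 1] (f '' E) = 0 := by
  obtain ⟨k, rfl⟩ : ∃ k, n = k + 1 := ⟨n - 1, by omega⟩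
  have hk : 2 ≤ k := by omega
  have hd1 : ((k + 1 : ℕ) : ℝ) - 1 = k := by push_cast; ring
  have hd2 : ((k + 1 : ℕ) : ℝ) - 2 = k - 1 := by push_cast; ring
  obtain ⟨⟨-, hDf, hibp⟩, hφint⟩ := hfW
  rw [CalderonCondition, hd2] at hCald
  rw [hd1]
  have hae := hDf.aestronglyMeasurable
  obtain ⟨D, hDm, hDD⟩ := hae
  have hDK : ∀ K ⊆ U, ∀ᵐ x ∂volume.restrict K, Df x = D x := fun K hK =>
    ae_restrict_of_ae_restrict_of_subset hK hDD
  have hD : IntegralByPartsOn volume U f D := by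
    intro ψ h1 h2 h3 v
    rw [← hibp ψ h1 h2 h3 v]
    refine integral_congr_ae ?_
    filter_upwards [hDD] with x hx
    rw [hx]
  have hDi : ∀ K ⊆ U, IsCompact K → ∫⁻ x in K, ‖D x‖ₑ ≠ ∞ := by
    intro K hKU hK
    have h := (hDf.integrableOn_compact_subset hKU hK).2.ne
    rwa [lintegral_congr_ae ((hDK K hKU).mono fun x hx => congrArg enorm hx)] at h
  have hHm : Measurable fun x => frobNorm (D x) :=
    (continuous_frobNorm.comp_stronglyMeasurable hDm).measurable
  have hGm := measurable_one_add_ofReal_comp hφmono hHm fun x => frobNorm_nonneg (D x)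
  have hGi : ∀ K ⊆ U, IsCompact K → ∫⁻ x in K, (1 + ENNReal.ofReal (φ (frobNorm (D x)))) ≠ ∞ := by
    intro K hKU hK
    rw [← lintegral_congr_ae ((hDK K hKU).mono fun x hx => by simp only [hx] :
      (fun x => 1 + ENNReal.ofReal (φ (frobNorm (Df x)))) =ᵐ[volume.restrict K] _),
      lintegral_add_left measurable_const]
    refine ENNReal.add_ne_top.2 ⟨?_, (hφint K hKU hK).ne⟩
    simpa using hK.measure_lt_top.ne
  have hball : ∀ x : Euc (k + 1), ∃ r : ℝ, x ∈ U → 0 < r ∧ closedBall x r ⊆ U := fun x => by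
    by_cases hx : x ∈ U
    · obtain ⟨r, hr⟩ := nhds_basis_closedBall.mem_iff.1 (hU.mem_nhds hx)
      exact ⟨r, fun _ => hr⟩
    · exact ⟨0, fun h => absurd h hx⟩
  choose r hr using hball
  obtain ⟨t, htU, ht, hcov⟩ := TopologicalSpace.countable_cover_nhdsWithin
    (f := fun x => ball x (r x)) (s := U)
    fun x hx => mem_nhdsWithin_of_mem_nhds (ball_mem_nhds x (hr x hx).1)
  have hloc : ∀ᵐ c : ℝ, ∀ x ∈ t, ∫⁻ y in sliceMap j₀ c ⁻¹' closedBall x (r x),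
      (1 + ENNReal.ofReal (φ (frobNorm (D (sliceMap j₀ c y))))) ≠ ∞ :=
    (ae_ball_iff ht).2 fun x hx => ae_slice_setLIntegral_ne_top j₀ measurableSet_closedBall hGm
      (hGi _ (hr x (htU hx)).2 (isCompact_closedBall _ _))
  have hslice : ∀ᵐ c : ℝ, ∀ᵐ y : Fin k → ℝ, sliceMap j₀ c y ∈ U →
      Df (sliceMap j₀ c y) = D (sliceMap j₀ c y) :=
    ae_slice_of_ae j₀ ((ae_restrict_iff' hU.measurableSet).1 hDD)
  filter_upwards [hloc, hslice, ae_exists_hausdorffMeasure_image_slice_le hk hφmono hCald.ne hU hfc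
    hD hDm hDi j₀] with c hfin hDc ⟨C, hC, hmain⟩
  have hu : ∀ x ∈ t, ∫⁻ y in sliceMap j₀ c ⁻¹' ball x (r x),
      gradDensity φ (frobNorm (D (sliceMap j₀ c y))) ≠ ∞ := fun x hx =>
    ne_top_of_le_ne_top (hfin x hx) (lintegral_mono' (Measure.restrict_mono
      (preimage_mono ball_subset_closedBall) le_rfl) fun y => gradDensity_le φ _)
  obtain ⟨hN, hAC, hnull⟩ := lusin_locAbsCont_null_of_hausdorffMeasure_image_le
    (volume_preimage_sliceMap_le j₀ c) (P := {x | x j₀ = c}) (f := f)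
    (Z := {x | x ∈ U ∧ frobNorm (Df x) = 0}) hC ht (fun x _ => isOpen_ball) hcov hu
    (fun x hx B hB => by
      have h := hmain _ (isOpen_ball.preimage (continuous_sliceMap_right j₀ c))
        (preimage_mono (ball_subset_closedBall.trans (hr x (htU hx)).2)) (hu x hx)
        (sliceMap j₀ c ⁻¹' B) (preimage_mono fun z hz => (hB hz).2)
      rwa [← image_image f (sliceMap j₀ c), sliceMap_preimage_image fun z hz => (hB hz).1] at h)
    (fun x _ => by
      have hH0 : MeasurableSet {y | frobNorm (D (sliceMap j₀ c y)) = 0} :=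
        (hHm.comp (continuous_sliceMap_right j₀ c).measurable) (measurableSet_singleton 0)
      refine measure_mono_null (t := {y | frobNorm (D (sliceMap j₀ c y)) = 0} ∪
        {y | ¬ (sliceMap j₀ c y ∈ U → Df (sliceMap j₀ c y) = D (sliceMap j₀ c y))})
        (fun y hy => ?_) (measure_union_null ?_ ?_)
      · by_cases h : Df (sliceMap j₀ c y) = D (sliceMap j₀ c y)
        · exact Or.inl (by rw [mem_ofPred_eq, ← h]; exact hy.2)
        · exact Or.inr fun h' => h (h' hy.1)
      · rw [withDensity_apply _ hH0, setLIntegral_congr_fun hH0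
          (g := fun _ => 0) fun y hy => by
            simp [gradDensity, show frobNorm (D (sliceMap j₀ c y)) = 0 from hy]]
        simp
      · exact withDensity_absolutelyContinuous _ _ (Measure.absolutelyContinuous_of_le
          Measure.restrict_le_self hDc))
  exact ⟨hN, hAC, fun E hE hE0 => hnull E hE fun x hx => ⟨(hE hx).2, hE0 x hx⟩⟩
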